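/- Suppose the interval I = [−ln ρ(S⁻¹), ln ρ(S)] has nonempty interior, i.e. −ln ρ(S⁻¹) < ln ρ(S). Then for every multiplier M on H there exists a holomorphic function μ on the interior of the strip Ω = {z ∈ ℂ : −ln ρ(S⁻¹) ≤ Im z ≤ ln ρ(S)} such that for every a in the open interval (−ln ρ(S⁻¹), ln ρ(S)) and every f ∈ C_c(ℝ), one has F((Mf)_a)(t) = μ(t + ia) · F((f)_a)(t) for almost every t ∈ ℝ. -/

import Mathlib

open MeasureTheory Complex Real Filter Topology

noncomputable section

/-- A Hilbert space `H` of (locally integrable) functions on `ℝ` satisfying the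
hypotheses (H1)-(H4) of the paper. -/
structure MultiplierSetup (H : Type) [NormedAddCommGroup H]
    [InnerProductSpace ℂ H] [CompleteSpace H] where
  /-- the inclusion of `H` into (a.e. classes of) functions on `ℝ` -/
  ι : H →ₗ[ℂ] (ℝ →ₘ[volume] ℂ)
  ι_inj : Function.Injective ι
  /-- `H ⊆ L¹_loc(ℝ)` -/
  locInt : ∀ f : H, LocallyIntegrable (ι f) volume
  /-- `C_c(ℝ) ⊆ H` -/
  ofCc : CompactlySupportedContinuousMap ℝ ℂ → H
  ofCc_spec : ∀ φ : CompactlySupportedContinuousMap ℝ ℂ,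
    (ι (ofCc φ) : ℝ → ℂ) =ᵐ[volume] φ
  /-- `C_c(ℝ)` is dense in `H` -/
  ofCc_dense : DenseRange ofCc
  /-- (H1): both inclusions are continuous -/
  incl_cont : ∀ K : Set ℝ, IsCompact K → ∃ c > 0,
    (∀ φ : CompactlySupportedContinuousMap ℝ ℂ, tsupport (φ : ℝ → ℂ) ⊆ K →
      ‖ofCc φ‖ ≤ c * ⨆ x, ‖φ x‖) ∧
    (∀ f : H, (∫ x in K, ‖(ι f : ℝ → ℂ) x‖) ≤ c * ‖f‖)
  /-- (H2): the translation group acting boundedly on `H` -/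
  S : ℝ → H →L[ℂ] H
  S_spec : ∀ (x : ℝ) (f : H), ((ι (S x f)) : ℝ → ℂ) =ᵐ[volume]
    fun y => (ι f : ℝ → ℂ) (y - x)
  S_add : ∀ x y : ℝ, (S x).comp (S y) = S (x + y)
  S_zero : S 0 = 1
  S_loc_bdd : ∀ K : Set ℝ, IsCompact K → ∃ C : ℝ, ∀ x ∈ K, ‖S x‖ ≤ C
  /-- (H3): the modulations act on `H`, uniformly boundedly -/
  T : ℝ → H →L[ℂ] H
  T_spec : ∀ (α : ℝ) (f : H), ((ι (T α f)) : ℝ → ℂ) =ᵐ[volume]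
    fun x => Complex.exp (Complex.I * α * x) * (ι f : ℝ → ℂ) x
  T_bdd : ∃ C : ℝ, ∀ α : ℝ, ‖T α‖ ≤ C
  /-- (H4): exponential bound on the norms of the translations -/
  S_exp : ∃ C > 0, ∃ a ≥ 0, ∀ x : ℝ, ‖S x‖ ≤ C * Real.exp (a * |x|)

open scoped FourierTransform ContDiff

theorem Continuous.eLpNorm_fourier_eq_of_hasCompactSupport {H : Type*} [NormedAddCommGroup H]
    [InnerProductSpace ℂ H] [CompleteSpace H] {G : ℝ → H} (hG : Continuous G)
    (hs : HasCompactSupport G) :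
    eLpNorm (𝓕 G) 2 volume = eLpNorm G 2 volume := by
  have hG2 : MemLp G 2 volume := hG.memLp_of_hasCompactSupport hs
  have hG1 : Integrable G := hG.integrable_of_hasCompactSupport hs
  have hcont : Continuous (𝓕 G) :=
    VectorFourier.fourierIntegral_continuous Real.continuous_fourierChar
      (by exact continuous_inner) hG1
  have key : (𝓕 (hG2.toLp G) : Lp H 2 (volume : Measure ℝ)) =ᵐ[volume] 𝓕 G := by
    refine ae_eq_of_integral_contDiff_smul_eq
      ((Lp.memLp _).locallyIntegrable (by norm_num)) hcont.locallyIntegrable ?_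
    intro g hg hgs
    have hg1 : HasCompactSupport (fun x => (g x : ℂ)) := hgs.comp_left Complex.ofReal_zero
    have hg2 : ContDiff ℝ ∞ (fun x => (g x : ℂ)) := Complex.ofRealCLM.contDiff.comp hg
    set u := hg1.toSchwartzMap hg2 with hu
    have hux : ∀ x, u x = (g x : ℂ) := fun x => rfl
    have h1 := congrArg (fun T => T u) (Lp.fourier_toTemperedDistribution_eq (hG2.toLp G))
    simp only [TemperedDistribution.fourier_apply, Lp.toTemperedDistribution_apply] at h1
    have h2 : ∫ x, (𝓕 u) x • (hG2.toLp G : ℝ → H) x = ∫ x, (𝓕 (u : ℝ → ℂ)) x • G x := by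
      refine integral_congr_ae ?_
      filter_upwards [hG2.coeFn_toLp] with x hx
      rw [hx, SchwartzMap.fourier_coe]
    have h3 : ∫ x, (𝓕 (u : ℝ → ℂ)) x • G x = ∫ x, u x • (𝓕 G) x := by
      simpa using! (VectorFourier.integral_fourierIntegral_smul_eq_flip (L := innerₗ ℝ)
        Real.continuous_fourierChar (by exact continuous_inner) u.integrable hG1)
    rw [h2, h3] at h1
    simpa [hux] using h1.symm
  have hn := Lp.norm_fourier_eq (hG2.toLp G)
  rw [Lp.norm_def, Lp.norm_def, eLpNorm_congr_ae key, eLpNorm_congr_ae hG2.coeFn_toLp] at hn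
  refine (ENNReal.toReal_eq_toReal_iff' ?_ hG2.2.ne).1 hn
  rw [← eLpNorm_congr_ae key]
  exact (Lp.memLp _).2.ne

/-- The translate `y ↦ φ (y - x)` of a compactly supported continuous function. -/
def CompactlySupportedContinuousMap.shift (x : ℝ) (φ : CompactlySupportedContinuousMap ℝ ℂ) :
    CompactlySupportedContinuousMap ℝ ℂ where
  toFun y := φ (y - x)
  continuous_toFun := by fun_prop
  hasCompactSupport' := φ.hasCompactSupport.comp_homeomorph (Homeomorph.subRight x)

/-- The product of a compactly supported continuous function with a continuous function. -/
def CompactlySupportedContinuousMap.mulContinuous (φ : CompactlySupportedContinuousMap ℝ ℂ)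
    (m : ℝ → ℂ) (hm : Continuous m) : CompactlySupportedContinuousMap ℝ ℂ where
  toFun y := φ y * m y
  continuous_toFun := by fun_prop
  hasCompactSupport' := φ.hasCompactSupport.mul_right

open scoped Pointwise

namespace MultiplierSetup

variable {H : Type} [NormedAddCommGroup H] [InnerProductSpace ℂ H] [CompleteSpace H]
  (P : MultiplierSetup H)

theorem eq_ofCc {h : H} {φ : CompactlySupportedContinuousMap ℝ ℂ}
    (hh : (P.ι h : ℝ → ℂ) =ᵐ[volume] φ) : h = P.ofCc φ :=
  P.ι_inj (AEEqFun.ext (hh.trans (P.ofCc_spec φ).symm))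

theorem ofCc_sub (φ ψ : CompactlySupportedContinuousMap ℝ ℂ) :
    P.ofCc (φ - ψ) = P.ofCc φ - P.ofCc ψ := by
  refine (P.eq_ofCc ?_).symm
  rw [map_sub]
  filter_upwards [AEEqFun.coeFn_sub (P.ι (P.ofCc φ)) (P.ι (P.ofCc ψ)), P.ofCc_spec φ,
    P.ofCc_spec ψ] with x h1 h2 h3
  simp [h1, h2, h3]

theorem S_ofCc (x : ℝ) (φ : CompactlySupportedContinuousMap ℝ ℂ) :
    P.S x (P.ofCc φ) = P.ofCc (φ.shift x) := by
  refine P.eq_ofCc ?_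
  filter_upwards [P.S_spec x (P.ofCc φ),
    (measurePreserving_sub_right volume x).quasiMeasurePreserving.ae (P.ofCc_spec φ)] with y h1 h2
  rw [h1, h2]; rfl

theorem S_apply_S (x y : ℝ) (h : H) : P.S x (P.S y h) = P.S (x + y) h := by
  rw [← P.S_add]; rfl

theorem S_neg_apply_S (x : ℝ) (h : H) : P.S (-x) (P.S x h) = h := by
  rw [S_apply_S]; simp [P.S_zero]

/-- Every element of `H` has finite `L¹` norm on compact sets. -/
theorem integrable_mul (ψ : CompactlySupportedContinuousMap ℝ ℂ) (h : H) :
    Integrable (fun u => (P.ι h : ℝ → ℂ) u * ψ u) := by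
  have := (P.locInt h).integrable_smul_left_of_hasCompactSupport ψ.continuous ψ.hasCompactSupport
  simpa [mul_comm] using this

/-- Integration against a compactly supported continuous function, as a functional on `H`. -/
def test (ψ : CompactlySupportedContinuousMap ℝ ℂ) : H →L[ℂ] ℂ :=
  LinearMap.mkContinuousOfExistsBound
    { toFun := fun h => ∫ u, (P.ι h : ℝ → ℂ) u * ψ u
      map_add' := by
        intro h k
        rw [← integral_add (P.integrable_mul ψ h) (P.integrable_mul ψ k)]
        refine integral_congr_ae ?_
        rw [map_add]
        filter_upwards [AEEqFun.coeFn_add (P.ι h) (P.ι k)] with u hu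
        simp [hu, add_mul]
      map_smul' := by
        intro c h
        simp only [RingHom.id_apply, smul_eq_mul]
        rw [← integral_const_mul]
        refine integral_congr_ae ?_
        rw [map_smul]
        filter_upwards [AEEqFun.coeFn_smul c (P.ι h)] with u hu
        simp [hu, mul_assoc] }
    (by
      obtain ⟨c, hc, -, h2⟩ := P.incl_cont (tsupport ψ) ψ.hasCompactSupport
      obtain ⟨B, hB⟩ := ψ.hasCompactSupport.exists_bound_of_continuous ψ.continuous
      refine ⟨B * c, fun h => ?_⟩
      have hB0 : 0 ≤ B := (norm_nonneg _).trans (hB 0)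
      have hInt : IntegrableOn (fun u => ‖(P.ι h : ℝ → ℂ) u‖) (tsupport ψ) :=
        ((P.locInt h).integrableOn_isCompact ψ.hasCompactSupport).norm
      calc ‖∫ u, (P.ι h : ℝ → ℂ) u * ψ u‖
          = ‖∫ u in tsupport ψ, (P.ι h : ℝ → ℂ) u * ψ u‖ := by
            rw [setIntegral_eq_integral_of_forall_compl_eq_zero]
            intro u hu
            rw [image_eq_zero_of_notMem_tsupport hu, mul_zero]
        _ ≤ ∫ u in tsupport ψ, ‖(P.ι h : ℝ → ℂ) u * ψ u‖ := norm_integral_le_integral_norm _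
        _ ≤ ∫ u in tsupport ψ, B * ‖(P.ι h : ℝ → ℂ) u‖ := by
            refine integral_mono (P.integrable_mul ψ h).norm.integrableOn (hInt.const_mul B) ?_
            intro u
            simp only [norm_mul]
            rw [mul_comm]
            gcongr
            exact hB u
        _ = B * ∫ u in tsupport ψ, ‖(P.ι h : ℝ → ℂ) u‖ := integral_const_mul _ _
        _ ≤ B * (c * ‖h‖) := by gcongr; exact h2 h
        _ = B * c * ‖h‖ := by ring)

theorem test_apply (ψ : CompactlySupportedContinuousMap ℝ ℂ) (h : H) :
    P.test ψ h = ∫ u, (P.ι h : ℝ → ℂ) u * ψ u := rfl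

theorem ext_test {h k : H} (hk : ∀ ψ, P.test ψ h = P.test ψ k) : h = k := by
  refine P.ι_inj (AEEqFun.ext ?_)
  refine ae_eq_of_integral_contDiff_smul_eq (P.locInt h) (P.locInt k) ?_
  intro g hg hgs
  have := hk ⟨⟨fun x => (g x : ℂ), by fun_prop⟩, hgs.comp_left Complex.ofReal_zero⟩
  rw [test_apply, test_apply] at this
  simpa [mul_comm] using this

theorem test_S (ψ : CompactlySupportedContinuousMap ℝ ℂ) (x : ℝ) (h : H) :
    P.test ψ (P.S x h) = ∫ u, (P.ι h : ℝ → ℂ) (u - x) * ψ u := by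
  rw [test_apply]
  refine integral_congr_ae ?_
  filter_upwards [P.S_spec x h] with u hu
  rw [hu]

theorem test_ofCc (ψ φ : CompactlySupportedContinuousMap ℝ ℂ) :
    P.test ψ (P.ofCc φ) = ∫ u, φ u * ψ u := by
  rw [test_apply]
  refine integral_congr_ae ?_
  filter_upwards [P.ofCc_spec φ] with u hu
  rw [hu]

theorem exists_S_norm_le : ∃ C > 0, ∃ a ≥ 0, ∀ (x : ℝ) (h : H),
    ‖P.S x h‖ ≤ C * Real.exp (a * |x|) * ‖h‖ := by
  obtain ⟨C, hC, a, ha, h⟩ := P.S_exp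
  exact ⟨C, hC, a, ha, fun x k => (P.S x).le_of_opNorm_le (h x) k⟩

theorem continuous_S_ofCc (φ : CompactlySupportedContinuousMap ℝ ℂ) :
    Continuous fun x => P.S x (P.ofCc φ) := by
  rw [continuous_iff_continuousAt]
  intro x₀
  simp only [S_ofCc]
  set K : Set ℝ := tsupport φ + Metric.closedBall x₀ 1 with hK
  have hKc : IsCompact K := φ.hasCompactSupport.isCompact.add (isCompact_closedBall _ _)
  obtain ⟨c, hc, h1, -⟩ := P.incl_cont K hKc
  have hsub : ∀ x ∈ Metric.closedBall x₀ 1, tsupport (φ.shift x) ⊆ K := by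
    intro x hx
    refine closure_minimal ?_ hKc.isClosed
    intro y hy
    refine ⟨y - x, subset_tsupport _ hy, x, hx, by ring⟩
  have huc : UniformContinuous φ :=
    φ.hasCompactSupport.uniformContinuous_of_continuous φ.continuous
  rw [Metric.continuousAt_iff]
  intro ε hε
  obtain ⟨δ, hδ, hφ⟩ := Metric.uniformContinuous_iff.1 huc (ε / (2 * c)) (by positivity)
  refine ⟨min δ 1, by positivity, fun x hx => ?_⟩
  have hx1 : x ∈ Metric.closedBall x₀ 1 := (hx.trans_le (min_le_right _ _)).le
  rw [dist_eq_norm, ← ofCc_sub]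
  have h2 := h1 (φ.shift x - φ.shift x₀) (by
    refine closure_minimal ?_ hKc.isClosed
    intro y hy
    by_contra hyK
    refine hy ?_
    have e1 := image_eq_zero_of_notMem_tsupport (fun h => hyK (hsub x hx1 h))
    have e2 := image_eq_zero_of_notMem_tsupport
      (fun h => hyK (hsub x₀ (Metric.mem_closedBall_self zero_le_one) h))
    simp [e1, e2])
  have h3 : (⨆ y, ‖(φ.shift x - φ.shift x₀) y‖) ≤ ε / (2 * c) := by
    refine ciSup_le fun y => ?_
    have : dist (y - x) (y - x₀) < δ := by
      rw [dist_sub_left]; exact hx.trans_le (min_le_left _ _)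
    have := (hφ this).le
    rwa [dist_eq_norm] at this
  calc _ ≤ c * (ε / (2 * c)) := h2.trans (by gcongr)
    _ = ε / 2 := by field_simp
    _ < ε := by linarith

theorem continuous_S (h : H) : Continuous fun x => P.S x h := by
  rw [continuous_iff_continuousAt]
  intro x₀
  obtain ⟨C, hC⟩ := P.S_loc_bdd (Metric.closedBall x₀ 1) (isCompact_closedBall _ _)
  have hC0 : 0 ≤ C := (norm_nonneg _).trans (hC x₀ (Metric.mem_closedBall_self zero_le_one))
  have hclosed : IsClosed {k : H | ContinuousOn (fun x => P.S x k) (Metric.closedBall x₀ 1)} := by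
    refine isClosed_of_closure_subset fun k hk => ?_
    refine continuousOn_of_uniform_approx_of_continuousOn fun u hu => ?_
    obtain ⟨ε, hε, hεu⟩ := Metric.mem_uniformity_dist.1 hu
    obtain ⟨k', hk', hd⟩ := Metric.mem_closure_iff.1 hk (ε / (C + 1)) (by positivity)
    refine ⟨fun x => P.S x k', hk', fun x hx => hεu ?_⟩
    rw [dist_eq_norm, ← map_sub]
    rw [dist_eq_norm] at hd
    calc ‖P.S x (k - k')‖ ≤ C * ‖k - k'‖ := (P.S x).le_of_opNorm_le (hC x hx) _
      _ ≤ (C + 1) * ‖k - k'‖ := by gcongr; linarith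
      _ < (C + 1) * (ε / (C + 1)) := by gcongr
      _ = ε := by field_simp
  have hall : ∀ k : H, ContinuousOn (fun x => P.S x k) (Metric.closedBall x₀ 1) := fun k =>
    P.ofCc_dense.induction_on (p := fun k => ContinuousOn (fun x => P.S x k) _) k hclosed
      fun φ => (P.continuous_S_ofCc φ).continuousOn
  exact (hall h).continuousAt (Metric.closedBall_mem_nhds _ zero_lt_one)

end MultiplierSetup

namespace MultiplierSetup

variable {H : Type} [NormedAddCommGroup H] [InnerProductSpace ℂ H] [CompleteSpace H]
  (P : MultiplierSetup H)

theorem continuous_smul_S (c : CompactlySupportedContinuousMap ℝ ℂ) (h : H) :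
    Continuous fun x => c x • P.S x h :=
  c.continuous.smul (P.continuous_S h)

theorem hasCompactSupport_smul_S (c : CompactlySupportedContinuousMap ℝ ℂ) (h : H) :
    HasCompactSupport fun x => c x • P.S x h :=
  c.hasCompactSupport.smul_right

theorem test_integral_smul_S (ψ c : CompactlySupportedContinuousMap ℝ ℂ) (h : H) :
    P.test ψ (∫ x, c x • P.S x h) = ∫ x, ∫ u, c x * ((P.ι h : ℝ → ℂ) (u - x) * ψ u) := by
  rw [← ContinuousLinearMap.integral_comp_comm]
  · simp only [map_smul, test_S, smul_eq_mul, integral_const_mul]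
  · exact (P.continuous_smul_S c h).integrable_of_hasCompactSupport
      (P.hasCompactSupport_smul_S c h)

theorem test_integral_smul_S_ofCc (ψ c φ : CompactlySupportedContinuousMap ℝ ℂ) :
    P.test ψ (∫ x, c x • P.S x (P.ofCc φ)) = ∫ x, ∫ u, c x * (φ (u - x) * ψ u) := by
  rw [← ContinuousLinearMap.integral_comp_comm]
  · simp only [map_smul, S_ofCc, test_ofCc, smul_eq_mul, integral_const_mul]
    rfl
  · exact (P.continuous_smul_S c _).integrable_of_hasCompactSupport
      (P.hasCompactSupport_smul_S c _)

theorem integral_convolution_swap (c φ ψ : CompactlySupportedContinuousMap ℝ ℂ) :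
    ∫ x, ∫ u, c x * (φ (u - x) * ψ u) = ∫ x, ∫ u, φ x * (c (u - x) * ψ u) := by
  have hswap : ∀ c φ : CompactlySupportedContinuousMap ℝ ℂ,
      ∫ x, ∫ u, c x * (φ (u - x) * ψ u) = ∫ u, ∫ x, c x * (φ (u - x) * ψ u) := by
    intro c φ
    refine integral_integral_swap_of_hasCompactSupport ?_ ?_
    · have := c.continuous
      have := φ.continuous
      have := ψ.continuous
      unfold Function.uncurry
      fun_prop
    · refine HasCompactSupport.intro (c.hasCompactSupport.isCompact.prod
        ψ.hasCompactSupport.isCompact) ?_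
      rintro ⟨x, u⟩ hxu
      rw [Set.mem_prod, not_and_or] at hxu
      rcases hxu with h | h
      · simp [Function.uncurry, image_eq_zero_of_notMem_tsupport h]
      · simp [Function.uncurry, image_eq_zero_of_notMem_tsupport h]
  rw [hswap, hswap]
  congr 1 with u
  rw [← integral_sub_left_eq_self (fun x => φ x * (c (u - x) * ψ u)) volume u]
  congr 1 with x
  rw [sub_sub_cancel]
  ring

theorem integral_smul_S_swap (c φ : CompactlySupportedContinuousMap ℝ ℂ) :
    ∫ x, c x • P.S x (P.ofCc φ) = ∫ x, φ x • P.S x (P.ofCc c) :=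
  P.ext_test fun ψ => by
    rw [test_integral_smul_S_ofCc, test_integral_smul_S_ofCc, integral_convolution_swap]

theorem T_ofCc (α : ℝ) (φ : CompactlySupportedContinuousMap ℝ ℂ) :
    P.T α (P.ofCc φ)
      = P.ofCc (φ.mulContinuous (fun x => cexp (I * α * x)) (by fun_prop)) := by
  refine P.eq_ofCc ?_
  filter_upwards [P.T_spec α (P.ofCc φ), P.ofCc_spec φ] with y h1 h2
  rw [h1, h2, mul_comm]; rfl

theorem T_S (α x : ℝ) (h : H) : P.T α (P.S x h) = cexp (I * α * x) • P.S x (P.T α h) := by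
  refine P.ι_inj (AEEqFun.ext ?_)
  rw [map_smul]
  filter_upwards [P.T_spec α (P.S x h), P.S_spec x h, P.S_spec x (P.T α h),
    AEEqFun.coeFn_smul (cexp (I * α * x)) (P.ι (P.S x (P.T α h))),
    (measurePreserving_sub_right volume x).quasiMeasurePreserving.ae (P.T_spec α h)]
    with y h1 h2 h3 h4 h5
  rw [h1, h2, h4, Pi.smul_apply, h3, h5, smul_eq_mul, ← mul_assoc, ← Complex.exp_add]
  push_cast
  ring_nf

theorem fourier_smul_S_swap (φ g : CompactlySupportedContinuousMap ℝ ℂ) (α : ℝ) :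
    𝓕 (fun y => g y • P.S y (P.ofCc φ)) α
      = P.T (-2 * π * α) (𝓕 (fun x => φ x • P.S x (P.ofCc g)) (-α)) := by
  have hT : ∀ (c : CompactlySupportedContinuousMap ℝ ℂ) (h : H),
      P.T (-2 * π * α) (∫ x, c x • P.S x h) = ∫ x, P.T (-2 * π * α) (c x • P.S x h) := by
    intro c h
    rw [ContinuousLinearMap.integral_comp_comm]
    exact (P.continuous_smul_S c _).integrable_of_hasCompactSupport
      (P.hasCompactSupport_smul_S c _)
  have e1 := P.integral_smul_S_swap
    (g.mulContinuous (fun y => cexp (I * ((-2 * π * α : ℝ) : ℂ) * y)) (by fun_prop)) φ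
  have e2 := hT (φ.mulContinuous (fun y => cexp (I * ((2 * π * α : ℝ) : ℂ) * y))
    (by fun_prop)) (P.ofCc g)
  rw [Real.fourier_real_eq_integral_exp_smul, Real.fourier_real_eq_integral_exp_smul]
  have e3 : ∫ v : ℝ, cexp (↑(-2 * π * v * -α) * I) • φ v • P.S v (P.ofCc g) =
      ∫ x, (φ.mulContinuous (fun y => cexp (I * ((2 * π * α : ℝ) : ℂ) * y))
        (by fun_prop)) x • P.S x (P.ofCc g) := by
    congr 1 with x
    rw [smul_smul, mul_comm]
    change (φ x * _) • _ = (φ x * _) • _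
    congr 3
    push_cast
    ring
  have e4 : ∫ v : ℝ, cexp (↑(-2 * π * v * α) * I) • g v • P.S v (P.ofCc φ) =
      ∫ x, (g.mulContinuous (fun y => cexp (I * ((-2 * π * α : ℝ) : ℂ) * y)) (by fun_prop)) x •
        P.S x (P.ofCc φ) := by
    congr 1 with x
    rw [smul_smul, mul_comm]
    change (g x * _) • _ = (g x * _) • _
    congr 3
    push_cast
    ring
  rw [e3, e4, e1, e2]
  congr 1 with x
  rw [map_smul, T_S, T_ofCc, smul_smul]
  congr 1
  change φ x = φ x * _ * _
  rw [mul_assoc, ← Complex.exp_add]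
  push_cast
  ring_nf
  simp

theorem exists_lintegral_smul_S_le : ∃ C : NNReal, ∀ φ g : CompactlySupportedContinuousMap ℝ ℂ,
    ∫⁻ y, ‖g y‖ₑ ^ 2 * ‖P.S y (P.ofCc φ)‖ₑ ^ 2
      ≤ C * ∫⁻ x, ‖φ x‖ₑ ^ 2 * ‖P.S x (P.ofCc g)‖ₑ ^ 2 := by
  obtain ⟨C, hC⟩ := P.T_bdd
  have hC0 : 0 ≤ C := (norm_nonneg _).trans (hC 0)
  refine ⟨C.toNNReal ^ 2, fun φ g => ?_⟩
  have hsq : ∀ c f : CompactlySupportedContinuousMap ℝ ℂ,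
      ∫⁻ y, ‖c y‖ₑ ^ 2 * ‖P.S y (P.ofCc f)‖ₑ ^ 2
        = eLpNorm (𝓕 fun y => c y • P.S y (P.ofCc f)) 2 volume ^ 2 := by
    intro c f
    rw [(P.continuous_smul_S c _).eLpNorm_fourier_eq_of_hasCompactSupport
      (P.hasCompactSupport_smul_S c _)]
    have := eLpNorm_nnreal_pow_eq_lintegral (μ := volume)
      (f := fun y => c y • P.S y (P.ofCc f)) (p := 2) two_ne_zero
    simp only [enorm_smul, NNReal.coe_ofNat, ENNReal.coe_ofNat] at this
    simp only [← ENNReal.rpow_natCast, Nat.cast_ofNat]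
    rw [this]
    congr 1 with y
    rw [ENNReal.mul_rpow_of_nonneg _ _ (by norm_num)]
  rw [hsq, hsq]
  have hcont : Continuous (𝓕 fun x => φ x • P.S x (P.ofCc g)) :=
    VectorFourier.fourierIntegral_continuous Real.continuous_fourierChar
      (by exact continuous_inner)
      ((P.continuous_smul_S φ _).integrable_of_hasCompactSupport (P.hasCompactSupport_smul_S φ _))
  have h1 := eLpNorm_le_nnreal_smul_eLpNorm_of_ae_le_mul (μ := volume)
    (f := 𝓕 fun y => g y • P.S y (P.ofCc φ))
    (g := (𝓕 fun x => φ x • P.S x (P.ofCc g)) ∘ Neg.neg) (c := C.toNNReal)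
    (Eventually.of_forall fun α => by
      rw [fourier_smul_S_swap, ← NNReal.coe_le_coe]
      push_cast
      rw [Real.coe_toNNReal _ hC0]
      exact (P.T _).le_of_opNorm_le (hC _) _) 2
  rw [eLpNorm_comp_measurePreserving hcont.aestronglyMeasurable
    (Measure.measurePreserving_neg volume)] at h1
  calc _ ≤ ((C.toNNReal : ENNReal) * eLpNorm (𝓕 fun x => φ x • P.S x (P.ofCc g)) 2 volume) ^ 2 := by
        gcongr; exact h1
    _ = _ := by rw [mul_pow]; simp

end MultiplierSetup

theorem CompactlySupportedContinuousMap.lintegral_enorm_sq_mul_ofReal_lt_top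
    (g : CompactlySupportedContinuousMap ℝ ℂ) {m : ℝ → ℝ} (hm : Continuous m) :
    ∫⁻ x, ‖g x‖ₑ ^ 2 * ENNReal.ofReal (m x) < ⊤ := by
  have hInt : Integrable fun x => ‖g x‖ ^ 2 * m x := by
    refine Continuous.integrable_of_hasCompactSupport (by fun_prop) ?_
    exact (g.hasCompactSupport.comp_left (g := fun z => ‖z‖ ^ 2) (by simp)).mul_right
  convert hInt.lintegral_lt_top using 3 with x
  rw [ENNReal.ofReal_mul (by positivity), ENNReal.ofReal_pow (norm_nonneg _), ofReal_norm]

namespace MultiplierSetup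

variable {H : Type} [NormedAddCommGroup H] [InnerProductSpace ℂ H] [CompleteSpace H]
  (P : MultiplierSetup H)

theorem exists_growth : ∃ m : ℝ → ℝ, Continuous m ∧ (∀ x, 0 < m x) ∧ (∀ x, m (-x) = m x) ∧
    ∀ (x : ℝ) (h : H), ‖P.S x h‖ₑ ≤ ENNReal.ofReal (m x) * ‖h‖ₑ := by
  obtain ⟨C, hC, a, ha, h⟩ := P.exists_S_norm_le
  refine ⟨fun x => C * Real.exp (a * |x|), by fun_prop, fun x => by positivity,
    fun x => by simp, fun x k => ?_⟩
  rw [← ofReal_norm, ← ofReal_norm, ← ENNReal.ofReal_mul (by positivity)]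
  exact ENNReal.ofReal_le_ofReal (h x k)

/-- Upper weighted `L²` bound for test functions. -/
theorem exists_lintegral_ofCc_le (g : CompactlySupportedContinuousMap ℝ ℂ) :
    ∃ C : NNReal, ∀ φ : CompactlySupportedContinuousMap ℝ ℂ,
      ∫⁻ x, ‖φ x‖ₑ ^ 2 * ‖P.S x (P.ofCc g)‖ₑ ^ 2 ≤ C * ‖P.ofCc φ‖ₑ ^ 2 := by
  obtain ⟨C, hC⟩ := P.exists_lintegral_smul_S_le
  obtain ⟨m, hm, hm0, -, hS⟩ := P.exists_growth
  have hfin := g.lintegral_enorm_sq_mul_ofReal_lt_top (m := fun x => m x ^ 2) (by fun_prop)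
  set A := ∫⁻ x, ‖g x‖ₑ ^ 2 * ENNReal.ofReal (m x ^ 2) with hA
  refine ⟨C * A.toNNReal, fun φ => (hC g φ).trans ?_⟩
  push_cast
  rw [ENNReal.coe_toNNReal hfin.ne, mul_assoc, hA, ← lintegral_mul_const' _ _ (by simp)]
  refine mul_le_mul_right (lintegral_mono fun x => ?_) _
  rw [mul_assoc]
  gcongr
  rw [ENNReal.ofReal_pow (hm0 x).le, ← mul_pow]
  gcongr
  exact hS x _

/-- Lower weighted `L²` bound for test functions. -/
theorem exists_ofCc_le_lintegral {g : CompactlySupportedContinuousMap ℝ ℂ} (hg : g ≠ 0) :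
    ∃ C : NNReal, ∀ φ : CompactlySupportedContinuousMap ℝ ℂ,
      ‖P.ofCc φ‖ₑ ^ 2 ≤ C * ∫⁻ x, ‖φ x‖ₑ ^ 2 * ‖P.S x (P.ofCc g)‖ₑ ^ 2 := by
  obtain ⟨C, hC⟩ := P.exists_lintegral_smul_S_le
  obtain ⟨m, hm, hm0, hms, hS⟩ := P.exists_growth
  have hcont : Continuous fun x => ((m x)⁻¹) ^ 2 := (hm.inv₀ fun x => (hm0 x).ne').pow 2
  have hfin := g.lintegral_enorm_sq_mul_ofReal_lt_top hcont
  set A := ∫⁻ x, ‖g x‖ₑ ^ 2 * ENNReal.ofReal ((m x)⁻¹ ^ 2) with hA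
  have hA0 : A ≠ 0 := by
    rw [hA]
    intro h0
    rw [lintegral_eq_zero_iff (by fun_prop)] at h0
    have h1 : (g : ℝ → ℂ) =ᵐ[volume] fun _ => (0 : ℂ) := by
      filter_upwards [h0] with x hx
      have : 0 < (m x)⁻¹ ^ 2 := by have := hm0 x; positivity
      simpa [this.not_ge, (hm0 x).ne'] using hx
    have h2 := (Continuous.ae_eq_iff_eq volume g.continuous continuous_const).1 h1
    exact hg (CompactlySupportedContinuousMap.ext fun x => congrFun h2 x)
  refine ⟨A⁻¹.toNNReal * C, fun φ => ?_⟩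
  have hAinv : ((A⁻¹.toNNReal : NNReal) : ENNReal) = A⁻¹ :=
    ENNReal.coe_toNNReal (by simpa using hA0)
  push_cast
  rw [hAinv, mul_assoc, ← ENNReal.div_eq_inv_mul, ENNReal.le_div_iff_mul_le (Or.inl hA0)
    (Or.inl hfin.ne)]
  refine le_trans ?_ (hC φ g)
  rw [mul_comm, hA, ← lintegral_mul_const' _ _ (by simp)]
  refine lintegral_mono fun x => ?_
  rw [mul_assoc]
  gcongr
  have hpos : 0 < (m x)⁻¹ := inv_pos.2 (hm0 x)
  rw [ENNReal.ofReal_pow hpos.le, ← mul_pow]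
  gcongr
  calc ENNReal.ofReal (m x)⁻¹ * ‖P.ofCc φ‖ₑ
      = ENNReal.ofReal (m x)⁻¹ * ‖P.S (-x) (P.S x (P.ofCc φ))‖ₑ := by rw [S_neg_apply_S]
    _ ≤ ENNReal.ofReal (m x)⁻¹ * (ENNReal.ofReal (m x) * ‖P.S x (P.ofCc φ)‖ₑ) := by
        gcongr; rw [← hms]; exact hS _ _
    _ = ‖P.S x (P.ofCc φ)‖ₑ := by
        rw [← mul_assoc, ← ENNReal.ofReal_mul hpos.le, inv_mul_cancel₀ (hm0 x).ne']; simp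

theorem exists_seq_ofCc_tendsto (h : H) : ∃ φ : ℕ → CompactlySupportedContinuousMap ℝ ℂ,
    Tendsto (fun n => P.ofCc (φ n)) atTop (𝓝 h) := by
  obtain ⟨u, hu, hlim⟩ := mem_closure_iff_seq_limit.1 (P.ofCc_dense h)
  choose φ hφ using hu
  exact ⟨φ, by simpa [hφ] using hlim⟩

/-- Upper weighted `L²` bound. -/
theorem exists_lintegral_le (g : CompactlySupportedContinuousMap ℝ ℂ) :
    ∃ C : NNReal, ∀ h : H,
      ∫⁻ x, ‖(P.ι h : ℝ → ℂ) x‖ₑ ^ 2 * ‖P.S x (P.ofCc g)‖ₑ ^ 2 ≤ C * ‖h‖ₑ ^ 2 := by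
  obtain ⟨C, hC⟩ := P.exists_lintegral_ofCc_le g
  refine ⟨C, fun h => ?_⟩
  have hω : Continuous fun x => P.S x (P.ofCc g) := P.continuous_S_ofCc g
  have hmeas : AEMeasurable
      (fun x => ‖(P.ι h : ℝ → ℂ) x‖ₑ ^ 2 * ‖P.S x (P.ofCc g)‖ₑ ^ 2) volume := by
    have := (P.ι h).aestronglyMeasurable.enorm
    have h2 : Measurable fun x => ‖P.S x (P.ofCc g)‖ₑ := hω.enorm.measurable
    fun_prop
  have hcover := aecover_Icc (μ := (volume : Measure ℝ)) (l := atTop)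
    (a := fun n : ℕ => -(n : ℝ)) (b := fun n : ℕ => (n : ℝ))
    (tendsto_neg_atTop_atBot.comp tendsto_natCast_atTop_atTop) tendsto_natCast_atTop_atTop
  refine le_of_tendsto' (hcover.lintegral_tendsto_of_countably_generated hmeas) fun n => ?_
  obtain ⟨φ, hφ⟩ := P.exists_seq_ofCc_tendsto h
  obtain ⟨c, hc, -, hc2⟩ := P.incl_cont (Set.Icc (-(n : ℝ)) n) isCompact_Icc
  set ν := (volume : Measure ℝ).restrict (Set.Icc (-(n : ℝ)) n) with hν
  have hL1 : Tendsto (fun k => eLpNorm ((φ k : ℝ → ℂ) - (P.ι h : ℝ → ℂ)) 1 ν) atTop (𝓝 0) := by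
    have hle : ∀ k, eLpNorm ((φ k : ℝ → ℂ) - (P.ι h : ℝ → ℂ)) 1 ν
        ≤ ENNReal.ofReal (c * ‖P.ofCc (φ k) - h‖) := by
      intro k
      have e1 : ((φ k : ℝ → ℂ) - (P.ι h : ℝ → ℂ)) =ᵐ[ν] P.ι (P.ofCc (φ k) - h) := by
        refine ae_restrict_of_ae ?_
        rw [map_sub]
        filter_upwards [AEEqFun.coeFn_sub (P.ι (P.ofCc (φ k))) (P.ι h), P.ofCc_spec (φ k)]
          with x h1 h2
        simp [h1, h2]
      rw [eLpNorm_congr_ae e1, eLpNorm_one_eq_lintegral_enorm,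
        ← ofReal_integral_norm_eq_lintegral_enorm]
      · exact ENNReal.ofReal_le_ofReal (hc2 _)
      · exact (P.locInt _).integrableOn_isCompact isCompact_Icc
    refine tendsto_of_tendsto_of_tendsto_of_le_of_le tendsto_const_nhds ?_
      (fun _ => zero_le) hle
    have h3 : Tendsto (fun k => c * ‖P.ofCc (φ k) - h‖) atTop (𝓝 0) := by
      simpa using (tendsto_iff_norm_sub_tendsto_zero.1 hφ).const_mul c
    simpa [Function.comp_def] using (ENNReal.continuous_ofReal.tendsto 0).comp h3
  obtain ⟨ns, hns, hae⟩ := (tendstoInMeasure_of_tendsto_eLpNorm one_ne_zero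
    (fun k => (φ k).continuous.aestronglyMeasurable)
    (P.ι h).aestronglyMeasurable.restrict hL1).exists_seq_tendsto_ae
  calc ∫⁻ x, ‖(P.ι h : ℝ → ℂ) x‖ₑ ^ 2 * ‖P.S x (P.ofCc g)‖ₑ ^ 2 ∂ν
      ≤ ∫⁻ x, liminf (fun k => ‖φ (ns k) x‖ₑ ^ 2 * ‖P.S x (P.ofCc g)‖ₑ ^ 2) atTop ∂ν := by
        refine lintegral_mono_ae ?_
        filter_upwards [hae] with x hx
        refine le_of_eq (Tendsto.liminf_eq ?_).symm
        refine ENNReal.Tendsto.mul_const ?_ (Or.inr (by simp))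
        exact ((ENNReal.continuous_pow 2).tendsto _).comp
          ((continuous_enorm.tendsto _).comp hx)
    _ ≤ liminf (fun k => ∫⁻ x, ‖φ (ns k) x‖ₑ ^ 2 * ‖P.S x (P.ofCc g)‖ₑ ^ 2 ∂ν) atTop := by
        refine lintegral_liminf_le fun k => ?_
        have h1 : Measurable fun x => ‖φ (ns k) x‖ₑ := (φ (ns k)).continuous.enorm.measurable
        have h2 : Measurable fun x => ‖P.S x (P.ofCc g)‖ₑ := hω.enorm.measurable
        fun_prop
    _ ≤ liminf (fun k => C * ‖P.ofCc (φ (ns k))‖ₑ ^ 2) atTop := by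
        refine liminf_le_liminf (Eventually.of_forall fun k => ?_)
        exact (lintegral_mono' Measure.restrict_le_self le_rfl).trans (hC _)
    _ = C * ‖h‖ₑ ^ 2 := by
        refine Tendsto.liminf_eq ?_
        refine ENNReal.Tendsto.const_mul ?_ (Or.inr (by simp))
        exact ((ENNReal.continuous_pow 2).tendsto _).comp
          ((continuous_enorm.tendsto _).comp (hφ.comp hns.tendsto_atTop))

end MultiplierSetup

theorem spectralRadius_pos_of_isUnit {A : Type*} [NormedRing A] [NormedAlgebra ℂ A]
    [CompleteSpace A] [Nontrivial A] {T : A} (hT : IsUnit T) : 0 < spectralRadius ℂ T := by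
  obtain ⟨z, hz⟩ := spectrum.nonempty T
  have hz0 : z ≠ 0 := fun h => spectrum.zero_notMem ℂ hT (h ▸ hz)
  refine lt_of_lt_of_le ?_ (le_iSup₂ (f := fun k (_ : k ∈ spectrum ℂ T) => (‖k‖₊ : ENNReal)) z hz)
  simpa using hz0

theorem exp_mul_log_spectralRadius_le {A : Type*} [NormedRing A] [NormedAlgebra ℂ A]
    [CompleteSpace A] [NormOneClass A] {T : A} (hT : IsUnit T) (n : ℕ) :
    Real.exp (n * Real.log (spectralRadius ℂ T).toReal) ≤ ‖T ^ n‖ := by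
  have : Nontrivial A := NormOneClass.nontrivial
  have hpos := spectralRadius_pos_of_isUnit hT
  have hfin : spectralRadius ℂ T ≠ ⊤ :=
    ((spectrum.spectralRadius_le_nnnorm T).trans_lt ENNReal.coe_lt_top).ne
  rw [mul_comm, Real.exp_mul, Real.exp_log (ENNReal.toReal_pos hpos.ne' hfin), Real.rpow_natCast]
  rcases n with _ | n
  · simp
  have h1 := spectrum.spectralRadius_le_pow_nnnorm_pow_one_div ℂ T n
  have h2 : spectralRadius ℂ T ^ (n + 1) ≤ (‖T ^ (n + 1)‖₊ : ENNReal) := by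
    have := ENNReal.rpow_le_rpow h1 (z := ((n + 1 : ℕ) : ℝ)) (by positivity)
    rw [ENNReal.rpow_natCast] at this
    refine this.trans_eq ?_
    rw [nnnorm_one, ENNReal.coe_one, ENNReal.one_rpow, mul_one, ← ENNReal.rpow_mul]
    push_cast
    rw [one_div_mul_cancel (by positivity), ENNReal.rpow_one]
  have h3 := ENNReal.toReal_mono (by simp) h2
  simpa using h3

theorem ContinuousLinearMap.opNorm_le_of_denseRange {E F ι : Type*} [SeminormedAddCommGroup E]
    [SeminormedAddCommGroup F] [NormedSpace ℂ E] [NormedSpace ℂ F] (T : E →L[ℂ] F) {e : ι → E}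
    (he : DenseRange e) {C : ℝ} (hC : 0 ≤ C) (h : ∀ i, ‖T (e i)‖ ≤ C * ‖e i‖) : ‖T‖ ≤ C :=
  T.opNorm_le_bound hC fun x => he.induction_on x (isClosed_le (by fun_prop) (by fun_prop)) h

namespace MultiplierSetup

variable {H : Type} [NormedAddCommGroup H] [InnerProductSpace ℂ H] [CompleteSpace H]
  (P : MultiplierSetup H)

theorem S_pow (x : ℝ) (n : ℕ) : P.S x ^ n = P.S (n * x) := by
  induction n with
  | zero => simp [P.S_zero]
  | succ n ih =>
    rw [pow_succ, ih]
    change (P.S _).comp (P.S _) = _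
    rw [P.S_add]
    congr 1
    push_cast
    ring

theorem isUnit_S (x : ℝ) : IsUnit (P.S x) := by
  refine ⟨⟨P.S x, P.S (-x), ?_, ?_⟩, rfl⟩
  · change (P.S x).comp (P.S (-x)) = 1
    rw [P.S_add, add_neg_cancel, P.S_zero]
  · change (P.S (-x)).comp (P.S x) = 1
    rw [P.S_add, neg_add_cancel, P.S_zero]

/-- A continuous weight `w`, moderate with respect to `m`, such that the norm of `H` is equivalent
to that of the weighted space `L²(w²)`. -/
structure IsWeight (w m : ℝ → ℝ) (C : NNReal) : Prop where
  continuous : Continuous w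
  pos : ∀ x, 0 < w x
  moderate : ∀ x y, w (x + y) ≤ m x * w y
  moderate_exp : ∃ D > 0, ∃ L ≥ 0, ∀ x, m x = D * Real.exp (L * |x|)
  ofCc_le : ∀ φ : CompactlySupportedContinuousMap ℝ ℂ,
    ‖P.ofCc φ‖ₑ ^ 2 ≤ C * ∫⁻ x, ‖φ x‖ₑ ^ 2 * ENNReal.ofReal (w x) ^ 2
  lintegral_le : ∀ h : H,
    ∫⁻ x, ‖(P.ι h : ℝ → ℂ) x‖ₑ ^ 2 * ENNReal.ofReal (w x) ^ 2 ≤ C * ‖h‖ₑ ^ 2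

theorem exists_ofCc_ne_zero : ∃ g : CompactlySupportedContinuousMap ℝ ℂ,
    g ≠ 0 ∧ P.ofCc g ≠ 0 := by
  obtain ⟨g, hg⟩ : ∃ g : CompactlySupportedContinuousMap ℝ ℂ, g ≠ 0 := by
    let b : ContDiffBump (0 : ℝ) := default
    refine ⟨⟨⟨fun x => (b x : ℂ), by have := b.continuous; fun_prop⟩,
      b.hasCompactSupport.comp_left Complex.ofReal_zero⟩, fun h => ?_⟩
    have h1 := DFunLike.congr_fun h (0 : ℝ)
    have h2 : ((b 0 : ℝ) : ℂ) = 0 := h1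
    rw [b.one_of_mem_closedBall (Metric.mem_closedBall_self b.rIn_pos.le)] at h2
    simp at h2
  refine ⟨g, hg, fun h => hg ?_⟩
  have h1 := P.ofCc_spec g
  rw [h, map_zero] at h1
  have h2 := (Continuous.ae_eq_iff_eq volume g.continuous continuous_const).1
    (h1.symm.trans AEEqFun.coeFn_zero)
  exact CompactlySupportedContinuousMap.ext fun x => congrFun h2 x

theorem exists_isWeight : ∃ w m C, P.IsWeight w m C := by
  obtain ⟨g, hg, hg0⟩ := P.exists_ofCc_ne_zero
  obtain ⟨C₁, h₁⟩ := P.exists_ofCc_le_lintegral hg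
  obtain ⟨C₂, h₂⟩ := P.exists_lintegral_le g
  obtain ⟨D, hD, L, hL, hS⟩ := P.exists_S_norm_le
  refine ⟨fun x => ‖P.S x (P.ofCc g)‖, fun x => D * Real.exp (L * |x|), max C₁ C₂,
    (P.continuous_S_ofCc g).norm, fun x => ?_, fun x y => ?_, ⟨D, hD, L, hL, fun x => rfl⟩,
    fun φ => ?_, fun h => ?_⟩
  · refine norm_pos_iff.2 fun h => hg0 ?_
    rw [← P.S_neg_apply_S x (P.ofCc g), h, map_zero]
  · rw [← P.S_apply_S]
    exact hS _ _
  · simp only [ofReal_norm]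
    refine (h₁ φ).trans ?_
    gcongr
    exact le_max_left _ _
  · simp only [ofReal_norm]
    refine (h₂ h).trans ?_
    gcongr
    exact le_max_right _ _

namespace IsWeight

variable {P} {w m : ℝ → ℝ} {C : NNReal} (hw : P.IsWeight w m C)
include hw

theorem enorm_S_ofCc_le (y : ℝ) (φ : CompactlySupportedContinuousMap ℝ ℂ) :
    ‖P.S y (P.ofCc φ)‖ₑ ^ 2 ≤ C * ∫⁻ x, ‖φ x‖ₑ ^ 2 * ENNReal.ofReal (w (x + y)) ^ 2 := by
  rw [S_ofCc]
  refine (hw.ofCc_le _).trans_eq ?_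
  rw [← lintegral_add_right_eq_self _ y]
  have h1 : ∀ x, φ.shift y (x + y) = φ x := fun x => congrArg φ (add_sub_cancel_right x y)
  simp only [h1]

theorem norm_S_le_of_le {y κ : ℝ} (hκ : 0 ≤ κ) (h : ∀ x, w (x + y) ≤ κ * w x) :
    ‖P.S y‖ ≤ C * κ := by
  refine (P.S y).opNorm_le_of_denseRange P.ofCc_dense (by positivity) fun φ => ?_
  have h1 : ‖P.S y (P.ofCc φ)‖ₑ ^ 2
      ≤ (C * ENNReal.ofReal κ * ‖P.ofCc φ‖ₑ) ^ 2 := by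
    calc ‖P.S y (P.ofCc φ)‖ₑ ^ 2
        ≤ C * ∫⁻ x, ‖φ x‖ₑ ^ 2 * ENNReal.ofReal (w (x + y)) ^ 2 := hw.enorm_S_ofCc_le y φ
      _ ≤ C * ∫⁻ x, ENNReal.ofReal κ ^ 2 *
            (‖(P.ι (P.ofCc φ) : ℝ → ℂ) x‖ₑ ^ 2 * ENNReal.ofReal (w x) ^ 2) := by
          refine mul_le_mul_right (lintegral_mono_ae ?_) _
          filter_upwards [P.ofCc_spec φ] with x hx
          rw [hx, mul_left_comm, ← mul_pow (ENNReal.ofReal κ), ← ENNReal.ofReal_mul hκ]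
          gcongr
          exact h x
      _ ≤ C * (ENNReal.ofReal κ ^ 2 * (C * ‖P.ofCc φ‖ₑ ^ 2)) := by
          rw [lintegral_const_mul' _ _ (by simp)]
          gcongr
          exact hw.lintegral_le _
      _ = _ := by ring
  have h2 := (ENNReal.pow_le_pow_left_iff two_ne_zero).1 h1
  rw [← ofReal_norm, ← ofReal_norm, ← ENNReal.ofReal_coe_nnreal,
    ← ENNReal.ofReal_mul (by positivity), ← ENNReal.ofReal_mul (by positivity)] at h2
  exact (ENNReal.ofReal_le_ofReal_iff (by positivity)).1 h2

theorem exists_growth_point : ∃ c > 0, ∀ s : ℝ, ∀ n : ℕ, ∃ y,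
    c * Real.exp (n * Real.log (spectralRadius ℂ (P.S s)).toReal) * w y < w (y + n * s) := by
  have : Nontrivial H := by
    obtain ⟨g, -, hg⟩ := P.exists_ofCc_ne_zero
    exact ⟨_, _, hg⟩
  refine ⟨(C + 1 : ℝ)⁻¹, by positivity, fun s n => ?_⟩
  by_contra! hle
  have h1 := hw.norm_S_le_of_le (by positivity) hle
  have h2 := exp_mul_log_spectralRadius_le (P.isUnit_S s) n
  rw [P.S_pow] at h2
  have h3 := h2.trans h1
  have hE := Real.exp_pos (n * Real.log (spectralRadius ℂ (P.S s)).toReal)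
  rw [← mul_assoc] at h3
  have h4 : (C : ℝ) * (C + 1 : ℝ)⁻¹ < 1 := by
    rw [← div_eq_mul_inv, div_lt_one (by positivity)]
    linarith
  nlinarith

end IsWeight

end MultiplierSetup

/-- A function with at most linear oscillation which drops by a large amount and rises by a large
amount over some intervals of the same length is extremal in the middle of a long interval. -/
theorem exists_extr_window {h : ℝ → ℝ} (hc : Continuous h) {D L N n A B : ℝ} (hL : 0 ≤ L)
    (hn : 0 ≤ n) (hosc : ∀ x y, h (x + y) ≤ h y + D + L * |x|)
    (hA : h (A + n) + (D + L * N) < h A) (hB : h B + (D + L * N) < h (B + n)) :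
    ∃ Y, (∀ x, |x| ≤ N → h Y ≤ h (Y + x)) ∨ (∀ x, |x| ≤ N → h (Y + x) ≤ h Y) := by
  have hfar : ∀ x y, h y + (D + L * N) < h x → N < |x - y| := by
    intro x y hxy
    have h1 := hosc (x - y) y
    rw [sub_add_cancel] at h1
    by_contra! h2
    have := mul_le_mul_of_nonneg_left h2 hL
    linarith
  rcases le_total A B with hAB | hAB
  · obtain ⟨Y, ⟨hY1, hY2⟩, hY⟩ := isCompact_Icc.exists_isMinOn
      (Set.nonempty_Icc.2 (show A ≤ B + n by linarith)) hc.continuousOn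
    have hY := isMinOn_iff.1 hY
    have e1 := hfar A Y (by have := hY (A + n) ⟨by linarith, by linarith⟩; linarith)
    have e2 := hfar (B + n) Y (by have := hY B ⟨by linarith, by linarith⟩; linarith)
    rw [abs_of_nonpos (by linarith)] at e1
    rw [abs_of_nonneg (by linarith)] at e2
    refine ⟨Y, Or.inl fun x hx => hY _ ?_⟩
    have := abs_le.1 hx
    exact ⟨by linarith, by linarith⟩
  · obtain ⟨Y, ⟨hY1, hY2⟩, hY⟩ := isCompact_Icc.exists_isMaxOn
      (Set.nonempty_Icc.2 (show B ≤ A + n by linarith)) hc.continuousOn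
    have hY := isMaxOn_iff.1 hY
    have e1 := hfar Y B (by have := hY (B + n) ⟨by linarith, by linarith⟩; linarith)
    have e2 := hfar Y (A + n) (by have := hY A ⟨by linarith, by linarith⟩; linarith)
    rw [abs_of_nonneg (by linarith)] at e1
    rw [abs_of_nonpos (by linarith)] at e2
    refine ⟨Y, Or.inr fun x hx => hY _ ?_⟩
    have := abs_le.1 hx
    exact ⟨by linarith, by linarith⟩

namespace MultiplierSetup.IsWeight

variable {H : Type} [NormedAddCommGroup H] [InnerProductSpace ℂ H] [CompleteSpace H]
  {P : MultiplierSetup H} {w m : ℝ → ℝ} {C : NNReal} (hw : P.IsWeight w m C)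
include hw

/-- On arbitrarily long intervals the weight is comparable from one side with `exp (a * x)`. -/
theorem exists_window {a : ℝ} (ha1 : -Real.log ((spectralRadius ℂ (P.S (-1))).toReal) < a)
    (ha2 : a < Real.log ((spectralRadius ℂ (P.S 1)).toReal)) (N : ℝ) :
    ∃ Y, (∀ x, |x| ≤ N → Real.exp (a * x) * w Y ≤ w (x + Y)) ∨
      (∀ x, |x| ≤ N → w (x + Y) ≤ Real.exp (a * x) * w Y) := by
  obtain ⟨D, hD, L, hL, hm⟩ := hw.moderate_exp
  obtain ⟨c, hc, hg⟩ := hw.exists_growth_point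
  set β := Real.log ((spectralRadius ℂ (P.S 1)).toReal)
  set β' := Real.log ((spectralRadius ℂ (P.S (-1))).toReal)
  set h : ℝ → ℝ := fun y => Real.log (w y) - a * y with hh
  have hcont : Continuous h := by
    have := hw.continuous.log fun x => (hw.pos x).ne'
    fun_prop
  set K := Real.log D + (L + |a|) * N with hK
  obtain ⟨n, hn⟩ := exists_nat_gt (max ((K - Real.log c) / (β - a)) ((K - Real.log c) / (a + β')))
  rw [max_lt_iff, div_lt_iff₀ (by linarith), div_lt_iff₀ (by linarith)] at hn
  have hgrow : ∀ (s γ y : ℝ), c * Real.exp (n * γ) * w y < w (y + n * s) →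
      Real.log c + n * γ + Real.log (w y) < Real.log (w (y + n * s)) := by
    intro s γ y hy
    have hwy := hw.pos y
    have := Real.log_lt_log (by positivity) hy
    rwa [Real.log_mul (by positivity) hwy.ne', Real.log_mul hc.ne' (by positivity),
      Real.log_exp] at this
  obtain ⟨B, hB⟩ := hg 1 n
  obtain ⟨A, hA⟩ := hg (-1) n
  have hB := hgrow _ _ _ hB
  have hA := hgrow _ _ _ hA
  have hosc : ∀ x y, h (x + y) ≤ h y + Real.log D + (L + |a|) * |x| := by
    intro x y
    have h1 := Real.log_le_log (hw.pos _) (hw.moderate x y)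
    rw [hm, Real.log_mul (by positivity) (hw.pos y).ne', Real.log_mul hD.ne' (by positivity),
      Real.log_exp] at h1
    have h2 : -(a * x) ≤ |a| * |x| := by rw [← abs_mul]; exact neg_le_abs _
    simp only [hh]
    linarith
  obtain ⟨Y, hY⟩ := exists_extr_window hcont (N := N) (n := n) (A := A + n * (-1)) (B := B)
    (by positivity) (by positivity) hosc
    (by simp only [hh]; rw [show A + n * (-1) + n = A by ring]; linarith)
    (by simp only [hh]; rw [mul_one] at hB; linarith)
  refine ⟨Y, hY.imp (fun hY x hx => ?_) fun hY x hx => ?_⟩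
  all_goals
    have h1 := hY x hx
    simp only [hh, add_comm Y x] at h1
    have hwy := hw.pos Y
    have hwx := hw.pos (x + Y)
    rw [← Real.log_le_log_iff (by positivity) (by positivity),
      Real.log_mul (by positivity) hwy.ne', Real.log_exp]
    linarith

end MultiplierSetup.IsWeight

namespace CompactlySupportedContinuousMap

theorem continuous_integral_mul_comp_sub (f : CompactlySupportedContinuousMap ℝ ℂ) {h : ℝ → ℂ}
    (hh : LocallyIntegrable h) : Continuous fun u => ∫ x, f x * h (u - x) :=
  HasCompactSupport.continuous_convolution_left (ContinuousLinearMap.mul ℂ ℂ)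
    f.hasCompactSupport f.continuous hh

theorem integral_integral_mul_comp_sub (f ψ : CompactlySupportedContinuousMap ℝ ℂ) {h : ℝ → ℂ}
    (hh : LocallyIntegrable h) :
    ∫ x, ∫ u, f x * (h (u - x) * ψ u) = ∫ u, (∫ x, f x * h (u - x)) * ψ u := by
  set K : Set ℝ := tsupport ψ - tsupport f with hK
  have hKc : IsCompact K := by
    rw [hK, sub_eq_add_neg]
    exact ψ.hasCompactSupport.isCompact.add f.hasCompactSupport.isCompact.neg
  have hInt : Integrable (K.indicator h) :=
    (hh.integrableOn_isCompact hKc).integrable_indicator hKc.measurableSet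
  have hf : Integrable f volume := f.continuous.integrable_of_hasCompactSupport f.hasCompactSupport
  have h1 := hf.convolution_integrand
    (ContinuousLinearMap.mul ℂ ℂ) hInt
  obtain ⟨c, hc⟩ := ψ.continuous.bounded_above_of_compact_support ψ.hasCompactSupport
  have h2 : Integrable (fun p : ℝ × ℝ => f p.2 * (h (p.1 - p.2) * ψ p.1))
      (volume.prod volume) := by
    have h3 := h1.bdd_mul (f := fun p : ℝ × ℝ => ψ p.1) (c := c)
      (by have := ψ.continuous; exact (by fun_prop : Continuous _).aestronglyMeasurable)
      (Eventually.of_forall fun p => hc _)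
    refine h3.congr (Eventually.of_forall fun p => ?_)
    simp only [ContinuousLinearMap.mul_apply']
    by_cases hψ : ψ p.1 = 0
    · simp [hψ]
    by_cases hf : f p.2 = 0
    · simp [hf]
    rw [Set.indicator_of_mem (Set.sub_mem_sub (subset_tsupport _ hψ) (subset_tsupport _ hf))]
    ring
  rw [← integral_integral_swap h2]
  refine integral_congr_ae (Eventually.of_forall fun u => ?_)
  simp only [← mul_assoc, integral_mul_const]

end CompactlySupportedContinuousMap

namespace MultiplierSetup

variable {H : Type} [NormedAddCommGroup H] [InnerProductSpace ℂ H] [CompleteSpace H]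
  (P : MultiplierSetup H)

/-- A multiplier commutes with convolution. -/
theorem convolution_map_swap {M : H →L[ℂ] H} (hM : ∀ x : ℝ, M.comp (P.S x) = (P.S x).comp M)
    (f g : CompactlySupportedContinuousMap ℝ ℂ) (u : ℝ) :
    ∫ x, f x * (P.ι (M (P.ofCc g)) : ℝ → ℂ) (u - x)
      = ∫ x, g x * (P.ι (M (P.ofCc f)) : ℝ → ℂ) (u - x) := by
  have hMS : ∀ f g : CompactlySupportedContinuousMap ℝ ℂ,
      M (∫ x, f x • P.S x (P.ofCc g)) = ∫ x, f x • P.S x (M (P.ofCc g)) := by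
    intro f g
    rw [← ContinuousLinearMap.integral_comp_comm]
    · refine integral_congr_ae (Eventually.of_forall fun x => ?_)
      have := DFunLike.congr_fun (hM x) (P.ofCc g)
      simpa using congrArg (f x • ·) this
    · exact (P.continuous_smul_S f _).integrable_of_hasCompactSupport
        (P.hasCompactSupport_smul_S f _)
  have key := congrArg M (P.integral_smul_S_swap f g)
  rw [hMS, hMS] at key
  have hF := fun f => P.locInt (M (P.ofCc f))
  have hcf := f.continuous_integral_mul_comp_sub (hF g)
  have hcg := g.continuous_integral_mul_comp_sub (hF f)
  refine congrFun ((Continuous.ae_eq_iff_eq volume hcf hcg).1 ?_) u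
  refine ae_eq_of_integral_contDiff_smul_eq hcf.locallyIntegrable hcg.locallyIntegrable ?_
  intro ψ hψ hψs
  have h1 := congrArg
    (P.test ⟨⟨fun x => (ψ x : ℂ), by fun_prop⟩, hψs.comp_left Complex.ofReal_zero⟩) key
  rw [test_integral_smul_S, test_integral_smul_S,
    CompactlySupportedContinuousMap.integral_integral_mul_comp_sub _ _ (hF g),
    CompactlySupportedContinuousMap.integral_integral_mul_comp_sub _ _ (hF f)] at h1
  simpa [mul_comm] using h1

end MultiplierSetup

theorem MeasureTheory.eLpNorm_two_sq {α E : Type*} [MeasurableSpace α] [NormedAddCommGroup E]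
    (f : α → E) (μ : Measure α) : eLpNorm f 2 μ ^ 2 = ∫⁻ x, ‖f x‖ₑ ^ 2 ∂μ := by
  simpa using eLpNorm_nnreal_pow_eq_lintegral (μ := μ) (f := f) (p := 2) two_ne_zero

theorem MeasureTheory.sq_lintegral_mul_le {α : Type*} [MeasurableSpace α] {μ : Measure α}
    {f g : α → ENNReal} (hf : AEMeasurable f μ) (hg : AEMeasurable g μ) :
    (∫⁻ x, f x * g x ∂μ) ^ 2 ≤ (∫⁻ x, f x ^ 2 ∂μ) * ∫⁻ x, g x ^ 2 ∂μ := by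
  have h1 := ENNReal.lintegral_mul_le_Lp_mul_Lq μ Real.HolderConjugate.two_two hf hg
  have h2 := pow_le_pow_left' h1 2
  rw [mul_pow, ← ENNReal.rpow_natCast (_ ^ _), ← ENNReal.rpow_natCast (_ ^ _), ← ENNReal.rpow_mul,
    ← ENNReal.rpow_mul] at h2
  simpa using h2

/-- A square integrable function whose pairing with compactly supported continuous functions is
bounded in the `L²` norm satisfies the same bound. -/
theorem MeasureTheory.MemLp.lintegral_enorm_sq_le_of_pairing_le {v : ℝ → ℂ} (hv : MemLp v 2)
    {B : NNReal} (h : ∀ k : CompactlySupportedContinuousMap ℝ ℂ,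
      ‖∫ x, k x * v x‖ₑ ^ 2 ≤ B * ∫⁻ x, ‖k x‖ₑ ^ 2) :
    ∫⁻ x, ‖v x‖ₑ ^ 2 ≤ B := by
  have hv' : MemLp (fun x => starRingEnd ℂ (v x)) 2 := hv.star
  set V := hv'.toLp with hV
  have hVn : ∫⁻ x, ‖v x‖ₑ ^ 2 = ‖V‖ₑ ^ 2 := by
    rw [hV, Lp.enorm_toLp, eLpNorm_two_sq]
    simp [enorm_eq_nnnorm]
  have hb : ∀ k : Lp ℂ 2 (volume : Measure ℝ), ‖inner ℂ V k‖ ≤ NNReal.sqrt B * ‖k‖ := by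
    refine fun k => (Lp.dense_hasCompactSupport_contDiff (E := ℝ) (F := ℂ) (μ := volume)
      (p := 2) (by simp)).induction ?_ (isClosed_le (by fun_prop) (by fun_prop)) k
    rintro k ⟨g, hg, hgs, hgc⟩
    have h1 := h ⟨⟨g, hgc.continuous⟩, hgs⟩
    have h2 : inner ℂ V k = ∫ x, g x * v x := by
      rw [L2.inner_def]
      refine integral_congr_ae ?_
      filter_upwards [hg, hv'.coeFn_toLp] with x h1 h2
      rw [h1, hV, h2]
      simp
    have h3 : ∫⁻ x, ‖g x‖ₑ ^ 2 = ‖k‖ₑ ^ 2 := by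
      rw [Lp.enorm_def, eLpNorm_two_sq]
      refine lintegral_congr_ae ?_
      filter_upwards [hg] with x h1
      rw [h1]
    have h4 : ‖inner ℂ V k‖ₑ ^ 2 ≤ ((NNReal.sqrt B : ENNReal) * ‖k‖ₑ) ^ 2 := by
      rw [h2, mul_pow, ← h3, ← ENNReal.coe_pow, NNReal.sq_sqrt]
      exact h1
    have h5 := (ENNReal.pow_le_pow_left_iff two_ne_zero).1 h4
    rw [enorm_eq_nnnorm, enorm_eq_nnnorm] at h5
    have h6 : ‖inner ℂ V k‖₊ ≤ NNReal.sqrt B * ‖k‖₊ := by exact_mod_cast h5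
    exact h6
  have h1 := hb V
  have h2 : ‖V‖ ≤ NNReal.sqrt B := by
    rw [inner_self_eq_norm_sq_to_K, norm_pow, RCLike.norm_ofReal, abs_norm] at h1
    by_contra! hlt
    nlinarith [NNReal.coe_nonneg (NNReal.sqrt B)]
  have h3 : ‖V‖₊ ≤ NNReal.sqrt B := h2
  rw [hVn, enorm_eq_nnnorm, ← NNReal.sq_sqrt B]
  exact_mod_cast pow_le_pow_left' h3 2

theorem Complex.enorm_ofReal_exp (x : ℝ) :
    ‖(Real.exp x : ℂ)‖ₑ = ENNReal.ofReal (Real.exp x) := by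
  rw [← ofReal_norm, Complex.norm_real, Real.norm_of_nonneg (by positivity)]

namespace MultiplierSetup.IsWeight

variable {H : Type} [NormedAddCommGroup H] [InnerProductSpace ℂ H] [CompleteSpace H]
  {P : MultiplierSetup H} {w m : ℝ → ℝ} {C : NNReal} (hw : P.IsWeight w m C)
include hw

theorem measurable_ofReal_add (Y : ℝ) : Measurable fun x => ENNReal.ofReal (w (x + Y)) := by
  have := hw.continuous
  exact (by fun_prop : Continuous fun x => w (x + Y)).measurable.ennreal_ofReal

theorem lintegral_map_le {M : H →L[ℂ] H} (hM : ∀ x : ℝ, M.comp (P.S x) = (P.S x).comp M)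
    (g : CompactlySupportedContinuousMap ℝ ℂ) (Y : ℝ) :
    ∫⁻ x, ‖(P.ι (M (P.ofCc g)) : ℝ → ℂ) x‖ₑ ^ 2 * ENNReal.ofReal (w (x + Y)) ^ 2
      ≤ C ^ 2 * ‖M‖ₑ ^ 2 * ∫⁻ x, ‖g x‖ₑ ^ 2 * ENNReal.ofReal (w (x + Y)) ^ 2 := by
  have hMS : P.S Y (M (P.ofCc g)) = M (P.S Y (P.ofCc g)) :=
    (DFunLike.congr_fun (hM Y) (P.ofCc g)).symm
  calc ∫⁻ x, ‖(P.ι (M (P.ofCc g)) : ℝ → ℂ) x‖ₑ ^ 2 * ENNReal.ofReal (w (x + Y)) ^ 2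
      = ∫⁻ x, ‖(P.ι (M (P.ofCc g)) : ℝ → ℂ) (x - Y)‖ₑ ^ 2 * ENNReal.ofReal (w x) ^ 2 := by
        rw [← lintegral_add_right_eq_self
          (fun x => ‖(P.ι (M (P.ofCc g)) : ℝ → ℂ) (x - Y)‖ₑ ^ 2 * _) Y]
        simp only [add_sub_cancel_right]
    _ = ∫⁻ x, ‖(P.ι (M (P.S Y (P.ofCc g))) : ℝ → ℂ) x‖ₑ ^ 2 * ENNReal.ofReal (w x) ^ 2 := by
        refine lintegral_congr_ae ?_
        rw [← hMS]
        filter_upwards [P.S_spec Y (M (P.ofCc g))] with x hx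
        rw [hx]
    _ ≤ C * ‖M (P.S Y (P.ofCc g))‖ₑ ^ 2 := hw.lintegral_le _
    _ ≤ C * (‖M‖ₑ * ‖P.S Y (P.ofCc g)‖ₑ) ^ 2 := by
        gcongr
        exact M.le_opENorm _
    _ = C * (‖M‖ₑ ^ 2 * ‖P.S Y (P.ofCc g)‖ₑ ^ 2) := by rw [mul_pow]
    _ ≤ C * (‖M‖ₑ ^ 2 *
          (C * ∫⁻ x, ‖g x‖ₑ ^ 2 * ENNReal.ofReal (w (x + Y)) ^ 2)) := by
        gcongr
        exact hw.enorm_S_ofCc_le Y g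
    _ = _ := by ring

theorem lintegral_moderate_lt_top (f : CompactlySupportedContinuousMap ℝ ℂ) :
    ∫⁻ x, ‖f x‖ₑ ^ 2 * ENNReal.ofReal (m x) ^ 2 < ⊤ := by
  obtain ⟨D, hD, L, hL, hm⟩ := hw.moderate_exp
  have hm' : m = fun x => D * Real.exp (L * |x|) := funext hm
  have h := f.lintegral_enorm_sq_mul_ofReal_lt_top (m := fun x => m x ^ 2)
    (by rw [hm']; fun_prop)
  refine lt_of_eq_of_lt (lintegral_congr fun x => ?_) h
  rw [ENNReal.ofReal_pow (by rw [hm]; positivity)]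

theorem setLIntegral_le_of_window_ge {M : H →L[ℂ] H}
    (hM : ∀ x : ℝ, M.comp (P.S x) = (P.S x).comp M) (f : CompactlySupportedContinuousMap ℝ ℂ)
    {a N Y : ℝ} (hY : ∀ x, |x| ≤ N → Real.exp (a * x) * w Y ≤ w (x + Y)) :
    ∫⁻ x in Set.Icc (-N) N,
        ‖(P.ι (M (P.ofCc f)) : ℝ → ℂ) x‖ₑ ^ 2 * ENNReal.ofReal (Real.exp (a * x)) ^ 2
      ≤ C ^ 2 * ‖M‖ₑ ^ 2 * ∫⁻ x, ‖f x‖ₑ ^ 2 * ENNReal.ofReal (m x) ^ 2 := by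
  have hwY : ENNReal.ofReal (w Y) ^ 2 ≠ 0 := by simpa using hw.pos Y
  rw [← ENNReal.mul_le_mul_iff_left hwY (by simp), ← lintegral_mul_const' _ _ (by simp), mul_assoc,
    ← lintegral_mul_const' _ _ (by simp)]
  calc _ ≤ ∫⁻ x in Set.Icc (-N) N,
        ‖(P.ι (M (P.ofCc f)) : ℝ → ℂ) x‖ₑ ^ 2 * ENNReal.ofReal (w (x + Y)) ^ 2 := by
        refine setLIntegral_mono' measurableSet_Icc fun x hx => ?_
        rw [mul_assoc, ← mul_pow, ← ENNReal.ofReal_mul (by positivity)]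
        gcongr
        exact hY x (abs_le.2 hx)
    _ ≤ ∫⁻ x, ‖(P.ι (M (P.ofCc f)) : ℝ → ℂ) x‖ₑ ^ 2 * ENNReal.ofReal (w (x + Y)) ^ 2 :=
        setLIntegral_le_lintegral _ _
    _ ≤ C ^ 2 * ‖M‖ₑ ^ 2 * ∫⁻ x, ‖f x‖ₑ ^ 2 * ENNReal.ofReal (w (x + Y)) ^ 2 :=
        hw.lintegral_map_le hM f Y
    _ ≤ _ := by
        refine mul_le_mul_right (lintegral_mono fun x => ?_) _
        rw [mul_assoc, ← mul_pow (ENNReal.ofReal _), ← ENNReal.ofReal_mul' (hw.pos Y).le]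
        gcongr
        exact hw.moderate x Y

theorem enorm_integral_mul_le_of_window_le {M : H →L[ℂ] H}
    (hM : ∀ x : ℝ, M.comp (P.S x) = (P.S x).comp M) (f k : CompactlySupportedContinuousMap ℝ ℂ)
    {a N Y : ℝ} (hY : ∀ x, |x| ≤ N → w (x + Y) ≤ Real.exp (a * x) * w Y)
    (hk : ∀ x, N < |x| → k x = 0) :
    ‖∫ x, k x * ((P.ι (M (P.ofCc f)) : ℝ → ℂ) x * Real.exp (a * x))‖ₑ ^ 2
      ≤ C ^ 2 * ‖M‖ₑ ^ 2 * (∫⁻ x, ‖f x‖ₑ ^ 2 * ENNReal.ofReal (m x) ^ 2) *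
        ∫⁻ x, ‖k x‖ₑ ^ 2 := by
  have hwY : ENNReal.ofReal (w Y) ^ 2 ≠ 0 := by simpa using hw.pos Y
  set g : CompactlySupportedContinuousMap ℝ ℂ :=
    ⟨⟨fun x => k (-x) * Real.exp (a * (-x)), by fun_prop⟩,
      (k.hasCompactSupport.comp_homeomorph (Homeomorph.neg ℝ)).mul_right⟩ with hg
  have hgx : ∀ x, g x = k (-x) * Real.exp (a * (-x)) := fun x => rfl
  have h1 := P.convolution_map_swap hM g f 0
  rw [← integral_neg_eq_self, ← integral_neg_eq_self (fun x => f x * _)] at h1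
  simp only [hgx, neg_neg, zero_sub] at h1
  have h2 : ∫ x, k x * ((P.ι (M (P.ofCc f)) : ℝ → ℂ) x * Real.exp (a * x))
      = ∫ x, f (-x) * (P.ι (M (P.ofCc g)) : ℝ → ℂ) x := by
    rw [← h1]
    exact integral_congr_ae (Eventually.of_forall fun x => by ring)
  have hA : ∫⁻ x, (‖f (-x)‖ₑ * ENNReal.ofReal (m (-x))) ^ 2
      = ∫⁻ x, ‖f x‖ₑ ^ 2 * ENNReal.ofReal (m x) ^ 2 := by
    rw [← lintegral_neg_eq_self (fun x => ‖f x‖ₑ ^ 2 * _)]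
    simp only [mul_pow]
  have hB : ∫⁻ x, ‖g x‖ₑ ^ 2 * ENNReal.ofReal (w (x + Y)) ^ 2
      ≤ (∫⁻ x, ‖k x‖ₑ ^ 2) * ENNReal.ofReal (w Y) ^ 2 := by
    rw [← lintegral_mul_const' _ _ (by simp), ← lintegral_neg_eq_self (fun x => ‖k x‖ₑ ^ 2 * _)]
    refine lintegral_mono fun x => ?_
    rcases lt_or_ge N |x| with hx | hx
    · rw [hgx, hk (-x) (by rwa [abs_neg])]
      simp
    · rw [hgx, enorm_mul, mul_pow, mul_assoc, ← mul_pow (‖_‖ₑ), Complex.enorm_ofReal_exp,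
        ← ENNReal.ofReal_mul (by positivity)]
      gcongr
      calc _ ≤ Real.exp (a * (-x)) * (Real.exp (a * x) * w Y) := by
            gcongr
            exact hY x hx
        _ = w Y := by rw [← mul_assoc, ← Real.exp_add]; simp
  obtain ⟨D, hD, L, hL, hm⟩ := hw.moderate_exp
  have hm' : m = fun x => D * Real.exp (L * |x|) := funext hm
  have hmc : Continuous fun x => m (-x) := by rw [hm']; fun_prop
  have hmeas1 : Measurable fun x => ‖f (-x)‖ₑ * ENNReal.ofReal (m (-x)) := by
    have h1 : Continuous fun x => f (-x) := by fun_prop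
    have h2 := h1.enorm.measurable
    have h3 := hmc.measurable
    exact h2.mul h3.ennreal_ofReal
  have hmeas2 : AEMeasurable fun x =>
      ‖(P.ι (M (P.ofCc g)) : ℝ → ℂ) x‖ₑ * ENNReal.ofReal (w (x + Y)) :=
    (P.ι (M (P.ofCc g))).aestronglyMeasurable.enorm.mul (hw.measurable_ofReal_add Y).aemeasurable
  rw [← ENNReal.mul_le_mul_iff_left hwY (by simp), h2, ← mul_pow]
  calc (‖∫ x, f (-x) * (P.ι (M (P.ofCc g)) : ℝ → ℂ) x‖ₑ * ENNReal.ofReal (w Y)) ^ 2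
      ≤ (∫⁻ x, (‖f (-x)‖ₑ * ENNReal.ofReal (m (-x))) *
          (‖(P.ι (M (P.ofCc g)) : ℝ → ℂ) x‖ₑ * ENNReal.ofReal (w (x + Y)))) ^ 2 := by
        gcongr
        grw [enorm_integral_le_lintegral_enorm]
        rw [← lintegral_mul_const' _ _ (by simp)]
        refine lintegral_mono fun x => ?_
        rw [enorm_mul, mul_mul_mul_comm, ← ENNReal.ofReal_mul' (hw.pos _).le]
        gcongr
        simpa using hw.moderate (-x) (x + Y)
    _ ≤ (∫⁻ x, (‖f (-x)‖ₑ * ENNReal.ofReal (m (-x))) ^ 2) *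
          ∫⁻ x, (‖(P.ι (M (P.ofCc g)) : ℝ → ℂ) x‖ₑ * ENNReal.ofReal (w (x + Y))) ^ 2 :=
        sq_lintegral_mul_le hmeas1.aemeasurable hmeas2
    _ ≤ (∫⁻ x, ‖f x‖ₑ ^ 2 * ENNReal.ofReal (m x) ^ 2) *
          (C ^ 2 * ‖M‖ₑ ^ 2 * ((∫⁻ x, ‖k x‖ₑ ^ 2) * ENNReal.ofReal (w Y) ^ 2)) := by
        rw [hA]
        simp only [mul_pow]
        grw [hw.lintegral_map_le hM g Y, hB]
    _ = _ := by ring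

end MultiplierSetup.IsWeight

namespace MultiplierSetup.IsWeight

variable {H : Type} [NormedAddCommGroup H] [InnerProductSpace ℂ H] [CompleteSpace H]
  {P : MultiplierSetup H} {w m : ℝ → ℝ} {C : NNReal} (hw : P.IsWeight w m C)
include hw

theorem memLp_mul {χ : ℝ → ℝ} (hχ : Continuous χ) (hχs : HasCompactSupport χ) (h : H) (a : ℝ) :
    MemLp (fun x => (χ x : ℂ) * ((P.ι h : ℝ → ℂ) x * Real.exp (a * x))) 2 := by
  have hmeas : AEStronglyMeasurable
      (fun x => (χ x : ℂ) * ((P.ι h : ℝ → ℂ) x * Real.exp (a * x))) volume := by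
    have h1 : Continuous fun x => (χ x : ℂ) := by fun_prop
    have h2 : Continuous fun x : ℝ => (Real.exp (a * x) : ℂ) := by fun_prop
    exact h1.aestronglyMeasurable.mul ((P.ι h).aestronglyMeasurable.mul h2.aestronglyMeasurable)
  have hw0 := fun x => (hw.pos x).ne'
  have hwc := hw.continuous
  have hq : Continuous fun x => χ x * (Real.exp (a * x) / w x) := by fun_prop (disch := assumption)
  obtain ⟨c, hc⟩ := hq.bounded_above_of_compact_support hχs.mul_right
  refine ⟨hmeas, ?_⟩
  refine (ENNReal.pow_lt_top_iff.1 ?_).resolve_right two_ne_zero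
  rw [eLpNorm_two_sq]
  calc ∫⁻ x, ‖(χ x : ℂ) * ((P.ι h : ℝ → ℂ) x * Real.exp (a * x))‖ₑ ^ 2
      ≤ ∫⁻ x, ENNReal.ofReal c ^ 2 *
          (‖(P.ι h : ℝ → ℂ) x‖ₑ ^ 2 * ENNReal.ofReal (w x) ^ 2) := by
        refine lintegral_mono fun x => ?_
        have h1 : (χ x : ℂ) * ((P.ι h : ℝ → ℂ) x * Real.exp (a * x))
            = (χ x * (Real.exp (a * x) / w x) : ℝ) * ((P.ι h : ℝ → ℂ) x * w x) := by
          have : (w x : ℂ) ≠ 0 := by exact_mod_cast hw0 x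
          push_cast
          field_simp
        rw [h1, enorm_mul, enorm_mul, ← mul_pow, ← mul_pow, ← ofReal_norm, ← ofReal_norm (w x : ℂ),
          Complex.norm_real, Complex.norm_real, Real.norm_of_nonneg (hw.pos x).le]
        gcongr
        exact hc x
    _ = ENNReal.ofReal c ^ 2 * ∫⁻ x, ‖(P.ι h : ℝ → ℂ) x‖ₑ ^ 2 * ENNReal.ofReal (w x) ^ 2 :=
        lintegral_const_mul' _ _ (by simp)
    _ < ⊤ := ENNReal.mul_lt_top (by simp) ((hw.lintegral_le h).trans_lt
        (ENNReal.mul_lt_top (by simp) (by simp)))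

theorem setLIntegral_le_of_window_le {M : H →L[ℂ] H}
    (hM : ∀ x : ℝ, M.comp (P.S x) = (P.S x).comp M) (f : CompactlySupportedContinuousMap ℝ ℂ)
    {a N Y : ℝ} (hN : 0 < N) (hY : ∀ x, |x| ≤ N + 1 → w (x + Y) ≤ Real.exp (a * x) * w Y) :
    ∫⁻ x in Set.Icc (-N) N,
        ‖(P.ι (M (P.ofCc f)) : ℝ → ℂ) x‖ₑ ^ 2 * ENNReal.ofReal (Real.exp (a * x)) ^ 2
      ≤ C ^ 2 * ‖M‖ₑ ^ 2 * ∫⁻ x, ‖f x‖ₑ ^ 2 * ENNReal.ofReal (m x) ^ 2 := by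
  let χ : ContDiffBump (0 : ℝ) := ⟨N, N + 1, hN, by linarith⟩
  set F : ℝ → ℂ := (P.ι (M (P.ofCc f)) : ℝ → ℂ) with hF
  set B := C ^ 2 * ‖M‖ₑ ^ 2 * ∫⁻ x, ‖f x‖ₑ ^ 2 * ENNReal.ofReal (m x) ^ 2 with hB
  have hBfin : B ≠ ⊤ := (ENNReal.mul_lt_top
    (ENNReal.mul_lt_top (by simp) (by simp)) (hw.lintegral_moderate_lt_top f)).ne
  have hle : ∫⁻ x, ‖(χ x : ℂ) * (F x * Real.exp (a * x))‖ₑ ^ 2 ≤ (B.toNNReal : ENNReal) := by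
    refine (hw.memLp_mul χ.continuous χ.hasCompactSupport _ a).lintegral_enorm_sq_le_of_pairing_le
      fun k => ?_
    have h1 := hw.enorm_integral_mul_le_of_window_le hM f
      (k.mulContinuous (fun x => (χ x : ℂ)) (by have := χ.continuous; fun_prop)) hY
      fun x hx => by
        have : χ x = 0 := χ.zero_of_le_dist (by simpa using hx.le)
        change k x * (χ x : ℂ) = 0
        simp [this]
    have h2 : ∀ x, k.mulContinuous (fun x => (χ x : ℂ)) (by have := χ.continuous; fun_prop) x
        = k x * χ x := fun x => rfl
    simp only [h2, mul_assoc] at h1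
    rw [ENNReal.coe_toNNReal hBfin]
    simp only [hB, mul_assoc]
    refine h1.trans ?_
    gcongr with x
    rw [enorm_mul]
    refine mul_le_of_le_one_right zero_le ?_
    rw [← ofReal_norm, Complex.norm_real, Real.norm_of_nonneg χ.nonneg]
    simpa using χ.le_one
  rw [ENNReal.coe_toNNReal hBfin] at hle
  refine le_trans ?_ ((setLIntegral_le_lintegral (Set.Icc (-N) N) _).trans hle)
  refine setLIntegral_mono' measurableSet_Icc fun x hx => ?_
  have h1 : χ x = 1 := χ.one_of_mem_closedBall (by simpa [abs_le] using hx)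
  rw [h1, Complex.ofReal_one, one_mul, enorm_mul, mul_pow, Complex.enorm_ofReal_exp]

/-- The image of a test function under a multiplier is square integrable with respect to
all exponential weights whose exponent lies in the open interval. -/
theorem lintegral_map_mul_exp_lt_top {M : H →L[ℂ] H}
    (hM : ∀ x : ℝ, M.comp (P.S x) = (P.S x).comp M) (f : CompactlySupportedContinuousMap ℝ ℂ)
    {a : ℝ} (ha1 : -Real.log ((spectralRadius ℂ (P.S (-1))).toReal) < a)
    (ha2 : a < Real.log ((spectralRadius ℂ (P.S 1)).toReal)) :
    ∫⁻ x, ‖(P.ι (M (P.ofCc f)) : ℝ → ℂ) x‖ₑ ^ 2 * ENNReal.ofReal (Real.exp (a * x)) ^ 2 < ⊤ := by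
  refine lt_of_le_of_lt ?_ (ENNReal.mul_lt_top
    (a := C ^ 2 * ‖M‖ₑ ^ 2) (ENNReal.mul_lt_top (by simp) (by simp)) (hw.lintegral_moderate_lt_top f))
  have hcover := aecover_Icc (μ := (volume : Measure ℝ)) (l := atTop)
    (a := fun n : ℕ => -((n : ℝ) + 1)) (b := fun n : ℕ => (n : ℝ) + 1)
    (tendsto_neg_atTop_atBot.comp
      (tendsto_atTop_add_const_right _ 1 tendsto_natCast_atTop_atTop))
    (tendsto_atTop_add_const_right _ 1 tendsto_natCast_atTop_atTop)
  have hmeas : AEMeasurable (fun x : ℝ => ‖(P.ι (M (P.ofCc f)) : ℝ → ℂ) x‖ₑ ^ 2 *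
      ENNReal.ofReal (Real.exp (a * x)) ^ 2) volume := by
    have h1 := (P.ι (M (P.ofCc f))).aestronglyMeasurable.enorm
    fun_prop
  refine le_of_tendsto' (hcover.lintegral_tendsto_of_countably_generated hmeas) fun n => ?_
  obtain ⟨Y, hY | hY⟩ := hw.exists_window ha1 ha2 ((n : ℝ) + 1 + 1)
  · exact hw.setLIntegral_le_of_window_ge hM f fun x hx => hY x (by linarith)
  · exact hw.setLIntegral_le_of_window_le hM f (by positivity) hY

end MultiplierSetup.IsWeight

theorem integrable_exp_neg_mul_abs {ε : ℝ} (hε : 0 < ε) :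
    Integrable fun x : ℝ => Real.exp (-ε * |x|) := by
  have h : IntegrableOn (fun x : ℝ => Real.exp (-ε * |x|)) (Set.Ioi 0) := by
    refine (exp_neg_integrableOn_Ioi 0 hε).congr_fun (fun x hx => ?_) measurableSet_Ioi
    rw [abs_of_pos hx]
  rw [← integrableOn_univ, ← Set.Iic_union_Ioi (a := (0 : ℝ)), integrableOn_union]
  refine ⟨?_, h⟩
  rw [integrableOn_Iic_iff_integrableOn_Iio]
  simpa using h.comp_neg

/-- Square integrability with respect to all exponential weights in an open interval
implies integrability. -/
theorem integrable_mul_exp_of_lintegral_sq_lt_top {F : ℝ → ℂ} (hF : AEStronglyMeasurable F volume)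
    {α β : ℝ} (h : ∀ a ∈ Set.Ioo α β,
      ∫⁻ x, ‖F x‖ₑ ^ 2 * ENNReal.ofReal (Real.exp (a * x)) ^ 2 < ⊤) {a : ℝ}
    (ha : a ∈ Set.Ioo α β) : Integrable fun x => ‖F x‖ * Real.exp (a * x) := by
  have hI : ∀ b ∈ Set.Ioo α β, Integrable fun x => (‖F x‖ * Real.exp (b * x)) ^ 2 := by
    intro b hb
    refine ⟨(hF.norm.mul (by fun_prop : Continuous fun x : ℝ =>
      Real.exp (b * x)).aestronglyMeasurable).pow 2, lt_of_eq_of_lt ?_ (h b hb)⟩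
    refine lintegral_congr fun x => ?_
    rw [Real.enorm_of_nonneg (by positivity), ENNReal.ofReal_pow (by positivity),
      ENNReal.ofReal_mul (norm_nonneg _), ofReal_norm, mul_pow]
  obtain ⟨ε, hε, h1, h2⟩ : ∃ ε > 0, a + ε < β ∧ α < a - ε := by
    obtain ⟨ε, hε, h⟩ := exists_between (lt_min (sub_pos.2 ha.1) (sub_pos.2 ha.2))
    rw [lt_min_iff] at h
    exact ⟨ε, hε, by linarith, by linarith⟩
  have hsum := ((hI (a + ε) ⟨by linarith, h1⟩).add (hI (a - ε) ⟨h2, by linarith⟩)).add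
    (integrable_exp_neg_mul_abs (ε := 2 * ε) (by positivity))
  refine hsum.mono' (hF.norm.mul (by fun_prop : Continuous fun x : ℝ =>
      Real.exp (a * x)).aestronglyMeasurable) (Eventually.of_forall fun x => ?_)
  rw [Real.norm_of_nonneg (by positivity)]
  have key : ∀ b, b * x = a * x + ε * |x| →
      ‖F x‖ * Real.exp (a * x) ≤ (‖F x‖ * Real.exp (b * x)) ^ 2 + Real.exp (-(2 * ε) * |x|) := by
    intro b hb
    have e1 : Real.exp (a * x) = Real.exp (b * x) * Real.exp (-ε * |x|) := by
      rw [← Real.exp_add]; congr 1; linarith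
    have e2 : Real.exp (-(2 * ε) * |x|) = Real.exp (-ε * |x|) ^ 2 := by
      rw [← Real.exp_nat_mul]; congr 1; push_cast; ring
    rw [e1, e2]
    nlinarith [sq_nonneg (‖F x‖ * Real.exp (b * x) - Real.exp (-ε * |x|)),
      sq_nonneg (‖F x‖ * Real.exp (b * x)), sq_nonneg (Real.exp (-ε * |x|))]
  simp only [Pi.add_apply]
  rcases le_total 0 x with hx | hx
  · have := key (a + ε) (by rw [abs_of_nonneg hx]; ring)
    have : 0 ≤ (‖F x‖ * Real.exp ((a - ε) * x)) ^ 2 := sq_nonneg _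
    linarith
  · have := key (a - ε) (by rw [abs_of_nonpos hx]; ring)
    have : 0 ≤ (‖F x‖ * Real.exp ((a + ε) * x)) ^ 2 := sq_nonneg _
    linarith

/-- The Fourier transform at complex frequencies. -/
def complexFourier (F : ℝ → ℂ) (z : ℂ) : ℂ := ∫ x : ℝ, F x * cexp (-(I * z * x))

theorem norm_cexp_neg_I_mul (z : ℂ) (x : ℝ) : ‖cexp (-(I * z * x))‖ = Real.exp (z.im * x) := by
  rw [Complex.norm_exp]
  congr 1
  simp

theorem integrable_mul_cexp {F : ℝ → ℂ} (hF : AEStronglyMeasurable F volume) {z : ℂ}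
    (h : Integrable fun x => ‖F x‖ * Real.exp (z.im * x)) :
    Integrable fun x : ℝ => F x * cexp (-(I * z * x)) := by
  refine h.mono' (hF.mul (by fun_prop : Continuous fun x : ℝ =>
    cexp (-(I * z * x))).aestronglyMeasurable) (Eventually.of_forall fun x => ?_)
  rw [norm_mul, norm_cexp_neg_I_mul]

theorem differentiableAt_complexFourier {F : ℝ → ℂ} (hF : AEStronglyMeasurable F volume)
    {α β : ℝ} (h : ∀ a ∈ Set.Ioo α β, Integrable fun x => ‖F x‖ * Real.exp (a * x)) {z : ℂ}
    (hz : z.im ∈ Set.Ioo α β) : DifferentiableAt ℂ (complexFourier F) z := by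
  obtain ⟨ε, hε, h1, h2⟩ : ∃ ε > 0, z.im + 2 * ε < β ∧ α < z.im - 2 * ε := by
    obtain ⟨ε, hε, h⟩ := exists_between (lt_min (sub_pos.2 hz.1) (sub_pos.2 hz.2))
    rw [lt_min_iff] at h
    exact ⟨ε / 2, by positivity, by linarith, by linarith⟩
  have hbound := ((h (z.im + 2 * ε) ⟨by linarith, h1⟩).add
    (h (z.im - 2 * ε) ⟨h2, by linarith⟩)).const_mul ε⁻¹
  have hmeas : ∀ w : ℂ, AEStronglyMeasurable (fun x : ℝ => cexp (-(I * w * x))) volume :=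
    fun w => (by fun_prop : Continuous fun x : ℝ => cexp (-(I * w * x))).aestronglyMeasurable
  refine (hasDerivAt_integral_of_dominated_loc_of_deriv_le (Metric.ball_mem_nhds z hε)
    (F := fun w x => F x * cexp (-(I * w * x)))
    (F' := fun w (x : ℝ) => F x * (cexp (-(I * w * x)) * (-(I * x))))
    (Eventually.of_forall fun w => hF.mul (hmeas w)) (integrable_mul_cexp hF (h _ hz))
    (hF.mul ((hmeas z).mul (by fun_prop : Continuous fun x : ℝ =>
      -(I * (x : ℂ))).aestronglyMeasurable)) (Eventually.of_forall fun x w hw => ?_)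
    hbound (Eventually.of_forall fun x w _ => ?_)).2.differentiableAt
  · simp only [norm_mul, norm_cexp_neg_I_mul, norm_neg, Complex.norm_I, Complex.norm_real, one_mul,
      Real.norm_eq_abs, Pi.add_apply]
    have hwz : |w.im - z.im| ≤ ε := by
      rw [← Complex.sub_im]
      refine (Complex.abs_im_le_norm _).trans ?_
      rw [← dist_eq_norm]
      exact (Metric.mem_ball.1 hw).le
    have e1 : ε * |x| ≤ Real.exp (ε * |x|) := by
      linarith [Real.add_one_le_exp (ε * |x|)]
    have e2 : w.im * x ≤ z.im * x + ε * |x| := by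
      have : (w.im - z.im) * x ≤ ε * |x| := (le_abs_self _).trans
        ((abs_mul _ _).trans_le (mul_le_mul_of_nonneg_right hwz (abs_nonneg x)))
      linarith
    have e3 : Real.exp (z.im * x + 2 * ε * |x|)
        ≤ Real.exp ((z.im + 2 * ε) * x) + Real.exp ((z.im - 2 * ε) * x) := by
      rcases le_total 0 x with hx | hx
      · rw [abs_of_nonneg hx, show z.im * x + 2 * ε * x = (z.im + 2 * ε) * x by ring]
        linarith [Real.exp_pos ((z.im - 2 * ε) * x)]
      · rw [abs_of_nonpos hx, show z.im * x + 2 * ε * -x = (z.im - 2 * ε) * x by ring]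
        linarith [Real.exp_pos ((z.im + 2 * ε) * x)]
    have e4 : Real.exp (w.im * x) * |x|
        ≤ ε⁻¹ * (Real.exp ((z.im + 2 * ε) * x) + Real.exp ((z.im - 2 * ε) * x)) := by
      rw [← div_eq_inv_mul, le_div_iff₀ hε]
      calc Real.exp (w.im * x) * |x| * ε = Real.exp (w.im * x) * (ε * |x|) := by ring
        _ ≤ Real.exp (z.im * x + ε * |x|) * Real.exp (ε * |x|) := by gcongr
        _ = Real.exp (z.im * x + 2 * ε * |x|) := by rw [← Real.exp_add]; congr 1; ring
        _ ≤ _ := e3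
    calc _ ≤ ‖F x‖ * (ε⁻¹ * (Real.exp ((z.im + 2 * ε) * x) + Real.exp ((z.im - 2 * ε) * x))) := by
          gcongr
      _ = _ := by ring
  · have h0 : HasDerivAt (fun w : ℂ => -(I * w * x)) (-(I * x)) w := by
      simpa using (((hasDerivAt_id w).const_mul I).mul_const (x : ℂ)).fun_neg
    exact h0.cexp.const_mul (F x)

theorem complexFourier_integral_mul_comp_sub {f g : ℝ → ℂ} {z : ℂ}
    (hf : Integrable fun x : ℝ => f x * cexp (-(I * z * x)))
    (hg : Integrable fun x : ℝ => g x * cexp (-(I * z * x))) :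
    complexFourier (fun u => ∫ x, f x * g (u - x)) z = complexFourier f z * complexFourier g z := by
  have h := integral_convolution (ContinuousLinearMap.mul ℂ ℂ) hf hg
  rw [ContinuousLinearMap.mul_apply'] at h
  rw [complexFourier, complexFourier, complexFourier, ← h]
  refine integral_congr_ae (Eventually.of_forall fun u => ?_)
  rw [convolution_def]
  simp only [ContinuousLinearMap.mul_apply']
  rw [← integral_mul_const]
  refine integral_congr_ae (Eventually.of_forall fun x => ?_)
  have : cexp (-(I * z * u)) = cexp (-(I * z * x)) * cexp (-(I * z * (u - x : ℝ))) := by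
    rw [← Complex.exp_add]; congr 1; push_cast; ring
  simp only [this]
  ring

theorem CompactlySupportedContinuousMap.integrable_norm_mul_exp
    (f : CompactlySupportedContinuousMap ℝ ℂ) (a : ℝ) :
    Integrable fun x => ‖f x‖ * Real.exp (a * x) :=
  Continuous.integrable_of_hasCompactSupport (by fun_prop) f.hasCompactSupport.norm.mul_right

theorem CompactlySupportedContinuousMap.exists_complexFourier_ne_zero (z : ℂ) :
    ∃ f : CompactlySupportedContinuousMap ℝ ℂ, complexFourier f z ≠ 0 := by
  let b : ContDiffBump (0 : ℝ) := default
  refine ⟨⟨⟨fun x => (b x : ℂ) * cexp (I * z * x), by have := b.continuous; fun_prop⟩,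
    (b.hasCompactSupport.comp_left Complex.ofReal_zero).mul_right⟩, ?_⟩
  have h : ∀ x : ℝ, (b x : ℂ) * cexp (I * z * x) * cexp (-(I * z * x)) = b x := fun x => by
    rw [mul_assoc, ← Complex.exp_add, add_neg_cancel, Complex.exp_zero, mul_one]
  change (∫ x : ℝ, (b x : ℂ) * cexp (I * z * x) * cexp (-(I * z * x))) ≠ 0
  simp only [h]
  rw [integral_complex_ofReal]
  exact_mod_cast b.integral_pos.ne'

namespace MultiplierSetup

variable {H : Type} [NormedAddCommGroup H] [InnerProductSpace ℂ H] [CompleteSpace H]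
  (P : MultiplierSetup H)

theorem integrable_norm_map_mul_exp {M : H →L[ℂ] H}
    (hM : ∀ x : ℝ, M.comp (P.S x) = (P.S x).comp M) (f : CompactlySupportedContinuousMap ℝ ℂ)
    {a : ℝ} (ha : a ∈ Set.Ioo (-Real.log ((spectralRadius ℂ (P.S (-1))).toReal))
      (Real.log ((spectralRadius ℂ (P.S 1)).toReal))) :
    Integrable fun x => ‖(P.ι (M (P.ofCc f)) : ℝ → ℂ) x‖ * Real.exp (a * x) := by
  obtain ⟨w, m, C, hw⟩ := P.exists_isWeight
  exact integrable_mul_exp_of_lintegral_sq_lt_top (AEEqFun.aestronglyMeasurable _)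
    (fun b hb => hw.lintegral_map_mul_exp_lt_top hM f hb.1 hb.2) ha

theorem complexFourier_map_mul_swap {M : H →L[ℂ] H}
    (hM : ∀ x : ℝ, M.comp (P.S x) = (P.S x).comp M) (f g : CompactlySupportedContinuousMap ℝ ℂ)
    {z : ℂ} (hz : z.im ∈ Set.Ioo (-Real.log ((spectralRadius ℂ (P.S (-1))).toReal))
      (Real.log ((spectralRadius ℂ (P.S 1)).toReal))) :
    complexFourier f z * complexFourier (P.ι (M (P.ofCc g))) z
      = complexFourier g z * complexFourier (P.ι (M (P.ofCc f))) z := by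
  have hmap : ∀ f, Integrable fun x : ℝ =>
      (P.ι (M (P.ofCc f)) : ℝ → ℂ) x * cexp (-(I * z * x)) := fun f =>
    integrable_mul_cexp (AEEqFun.aestronglyMeasurable _) (P.integrable_norm_map_mul_exp hM f hz)
  have hCc : ∀ f : CompactlySupportedContinuousMap ℝ ℂ, Integrable fun x : ℝ =>
      f x * cexp (-(I * z * x)) := fun f =>
    integrable_mul_cexp f.continuous.aestronglyMeasurable (f.integrable_norm_mul_exp _)
  rw [← complexFourier_integral_mul_comp_sub (hCc f) (hmap g),
    ← complexFourier_integral_mul_comp_sub (hCc g) (hmap f)]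
  simp only [P.convolution_map_swap hM f g]

end MultiplierSetup

theorem integral_mul_exp_mul_cexp_eq_complexFourier (F : ℝ → ℂ) (t a : ℝ) :
    ∫ x : ℝ, F x * Real.exp (a * x) * cexp (-(I * t * x)) = complexFourier F (t + I * a) := by
  refine integral_congr_ae (Eventually.of_forall fun x => ?_)
  simp only [mul_assoc, Complex.ofReal_exp, ← Complex.exp_add]
  congr 2
  push_cast
  linear_combination ((a : ℂ) * x) * Complex.I_mul_I

/-- **Theorem 1, part 3.** If the interval `I = [-log ρ(S⁻¹), log ρ(S)]` has nonempty
interior, then every multiplier `M` on `H` possesses a symbol `μ`, holomorphic on the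
interior of the strip `Ω = {z : -log ρ(S⁻¹) ≤ Im z ≤ log ρ(S)}`, satisfying
`𝓕((Mf)_a) (t) = μ(t + i a) ⬝ 𝓕((f)_a)(t)` a.e. for all `a` in the interior of `I`
and all `f ∈ C_c(ℝ)`. -/
theorem multiplier_symbol_holomorphic {H : Type} [NormedAddCommGroup H]
    [InnerProductSpace ℂ H] [CompleteSpace H] (P : MultiplierSetup H)
    (hI : -Real.log ((spectralRadius ℂ (P.S (-1))).toReal)
        < Real.log ((spectralRadius ℂ (P.S 1)).toReal))
    (M : H →L[ℂ] H) (hM : ∀ x : ℝ, M.comp (P.S x) = (P.S x).comp M) :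
    ∃ μ : ℂ → ℂ,
      DifferentiableOn ℂ μ
        {z : ℂ | -Real.log ((spectralRadius ℂ (P.S (-1))).toReal) < z.im ∧
          z.im < Real.log ((spectralRadius ℂ (P.S 1)).toReal)} ∧
      ∀ a : ℝ, a ∈ Set.Ioo (-Real.log ((spectralRadius ℂ (P.S (-1))).toReal))
          (Real.log ((spectralRadius ℂ (P.S 1)).toReal)) →
        ∀ f : CompactlySupportedContinuousMap ℝ ℂ, ∀ᵐ t : ℝ,
          (∫ x : ℝ, (P.ι (M (P.ofCc f)) : ℝ → ℂ) x * Real.exp (a * x) *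
              Complex.exp (-(Complex.I * t * x)))
            = μ (t + Complex.I * a) *
              ∫ x : ℝ, f x * Real.exp (a * x) * Complex.exp (-(Complex.I * t * x)) := by
  choose e he using CompactlySupportedContinuousMap.exists_complexFourier_ne_zero
  refine ⟨fun z => complexFourier (P.ι (M (P.ofCc (e z)))) z / complexFourier (e z) z,
    fun z hz => DifferentiableAt.differentiableWithinAt ?_, fun a ha f => ?_⟩
  · have h1 : DifferentiableAt ℂ (complexFourier (P.ι (M (P.ofCc (e z))))) z :=
      differentiableAt_complexFourier (AEEqFun.aestronglyMeasurable _)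
        (fun a ha => P.integrable_norm_map_mul_exp hM (e z) ha) hz
    have h2 : DifferentiableAt ℂ (complexFourier (e z)) z :=
      differentiableAt_complexFourier (e z).continuous.aestronglyMeasurable
        (fun a _ => (e z).integrable_norm_mul_exp a) hz
    refine (h1.div h2 (he z)).congr_of_eventuallyEq ?_
    have hopen : ∀ᶠ w : ℂ in 𝓝 z,
        w.im ∈ Set.Ioo (-Real.log ((spectralRadius ℂ (P.S (-1))).toReal))
          (Real.log ((spectralRadius ℂ (P.S 1)).toReal)) :=
      Complex.continuous_im.continuousAt.eventually (isOpen_Ioo.mem_nhds hz)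
    filter_upwards [hopen, h2.continuousAt.eventually_ne (he z)] with w hw1 hw2
    rw [Pi.div_apply, div_eq_div_iff (he w) hw2]
    have := P.complexFourier_map_mul_swap hM (e w) (e z) hw1
    linear_combination -this
  · refine Eventually.of_forall fun t => ?_
    rw [integral_mul_exp_mul_cexp_eq_complexFourier, integral_mul_exp_mul_cexp_eq_complexFourier]
    rw [div_mul_eq_mul_div, eq_div_iff (he _)]
    have := P.complexFourier_map_mul_swap hM (e (t + I * a)) f (z := t + I * a) (by simpa using ha)
    linear_combination this
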